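/- Let n ≥ 2 and 1 ≤ m < n. Let p₀, p_∞ ∈ [1,∞) and α₀, α_∞ ∈ ℝ, with α₀ ≤ 0 if p₀ = 1 and α_∞ ≥ 0 if p_∞ = 1, and let B be a Young function equivalent to t^{p₀}(1−log t)^{α₀} near zero and to t^{p_∞}(1+log t)^{α_∞} near infinity. Suppose that either p₀ = n/(n−m) and α₀ ≤ 0, or p₀ ∈ (n/(n−m), ∞). Then the Young function B_m constructed from B (via G_m) is equivalent near zero to t^{np₀/(n+mp₀)}(1−log t)^{nα₀/(n+mp₀)}, and equivalent near infinity to t^{np_∞/(n+mp_∞)}(1+log t)^{nα_∞/(n+mp_∞)} if p_∞ ∈ (n/(n−m), ∞) or (p_∞ = n/(n−m) and α_∞ > 0), and to t if (p_∞ = n/(n−m) and α_∞ ≤ 0) or p_∞ ∈ [1, n/(n−m)); and L^{B_m}(0,∞) is the optimal (largest) Orlicz domain space for L^B in the Hardy-type inequality ‖∫_t^∞ f(s)s^{m/n−1}ds‖_{L^B(0,∞)} ≤ C‖f‖_{L^A(0,∞)}. Conversely, if p₀ = n/(n−m) and α₀ > 0, or p₀ ∈ [1, n/(n−m)), then there exists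 no Young function A for which this Hardy-type inequality holds at all. -/

import Mathlib

open MeasureTheory Set Filter
open scoped ENNReal NNReal Topology

noncomputable section

/-- Lebesgue measure restricted to `(0,∞)`. -/
def mu0 : Measure ℝ := volume.restrict (Set.Ioi (0:ℝ))

/-- Decreasing rearrangement of an `ℝ≥0∞`-valued function w.r.t. a measure `μ`. -/
def rearrangement {α : Type*} [MeasurableSpace α] (μ : Measure α) (f : α → ℝ≥0∞) (t : ℝ) :
    ℝ≥0∞ :=
  sInf {l : ℝ≥0∞ | μ {x | l < f x} ≤ ENNReal.ofReal t}

/-- Decreasing rearrangement of a (nonnegative) function on `(0,∞)`. -/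
def rearr (f : ℝ → ℝ≥0∞) : ℝ → ℝ≥0∞ := rearrangement mu0 f

/-- The maximal rearrangement `f^{**}(t) = (1/t)∫_0^t f^*(s) ds`. -/
def doubleStar (f : ℝ → ℝ≥0∞) (t : ℝ) : ℝ≥0∞ :=
  (ENNReal.ofReal t)⁻¹ * ∫⁻ s in Set.Ioc (0:ℝ) t, rearr f s

/-- Rearrangement-invariant function norm on `(0,∞)` (axioms (P1)–(P6)). -/
structure IsRINorm (ρ : (ℝ → ℝ≥0∞) → ℝ≥0∞) : Prop where
  eq_zero_iff : ∀ f : ℝ → ℝ≥0∞, Measurable f → (ρ f = 0 ↔ f =ᵐ[mu0] 0)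
  smul : ∀ (c : ℝ≥0) (f : ℝ → ℝ≥0∞), Measurable f →
    ρ (fun t => (c : ℝ≥0∞) * f t) = c * ρ f
  triangle : ∀ f g : ℝ → ℝ≥0∞, Measurable f → Measurable g → ρ (f + g) ≤ ρ f + ρ g
  mono : ∀ f g : ℝ → ℝ≥0∞, Measurable f → Measurable g →
    (∀ᵐ t ∂mu0, f t ≤ g t) → ρ f ≤ ρ g
  fatou : ∀ (F : ℕ → ℝ → ℝ≥0∞) (f : ℝ → ℝ≥0∞), (∀ j, Measurable (F j)) → Measurable f →
    (∀ j t, F j t ≤ F (j + 1) t) → (∀ t, (⨆ j, F j t) = f t) → (⨆ j, ρ (F j)) = ρ f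
  indicator_lt_top : ∀ E : Set ℝ, MeasurableSet E → mu0 E < ∞ → ρ (E.indicator 1) < ∞
  local_L1 : ∀ E : Set ℝ, MeasurableSet E → mu0 E < ∞ → ∃ C : ℝ≥0∞, 0 < C ∧ C < ∞ ∧
    ∀ f : ℝ → ℝ≥0∞, Measurable f → (∫⁻ t in E, f t ∂mu0) ≤ C * ρ f
  rearr_inv : ∀ f g : ℝ → ℝ≥0∞, Measurable f → Measurable g → rearr f = rearr g → ρ f = ρ g

/-- The associate norm `ρ'`. -/
def associate (ρ : (ℝ → ℝ≥0∞) → ℝ≥0∞) (g : ℝ → ℝ≥0∞) : ℝ≥0∞ :=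
  ⨆ (f : ℝ → ℝ≥0∞) (_ : Measurable f) (_ : ρ f ≤ 1), ∫⁻ t, f t * g t ∂mu0

/-- The weighted Hardy-type operator `f ↦ (t ↦ ∫_t^∞ f(s) s^{m/n-1} ds)`. -/
def hardyOp (m n : ℕ) (f : ℝ → ℝ≥0∞) (t : ℝ) : ℝ≥0∞ :=
  ∫⁻ s in Set.Ioi t, f s * ENNReal.ofReal (s ^ ((m : ℝ)/(n : ℝ) - 1))

/-- The function `t ↦ t^{m/n-1} χ_{(1,∞)}(t)`. -/
def tailFun (m n : ℕ) (t : ℝ) : ℝ≥0∞ :=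
  ENNReal.ofReal (t ^ ((m : ℝ)/(n : ℝ) - 1)) * (Set.Ioi (1:ℝ)).indicator 1 t

/-- The functional `σ_m(f) = ρ'(t ↦ t^{m/n} f^{**}(t))`. -/
def sigmaFun (m n : ℕ) (ρ : (ℝ → ℝ≥0∞) → ℝ≥0∞) (f : ℝ → ℝ≥0∞) : ℝ≥0∞ :=
  associate ρ (fun t => ENNReal.ofReal (t ^ ((m : ℝ)/(n : ℝ))) * doubleStar f t)

/-- The optimal-domain functional `τ_m`. -/
def tauFun (m n : ℕ) (ρY : (ℝ → ℝ≥0∞) → ℝ≥0∞) (f : ℝ → ℝ≥0∞) : ℝ≥0∞ :=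
  ⨆ (h : ℝ → ℝ≥0∞) (_ : Measurable h) (_ : rearr h = rearr f), ρY (hardyOp m n h)

/-- The operator `T_α f(t) = t^{-α} sup_{t ≤ s} s^α f^*(s)`. -/
def supOp (α : ℝ) (f : ℝ → ℝ≥0∞) (t : ℝ) : ℝ≥0∞ :=
  ENNReal.ofReal (t ^ (-α)) * ⨆ (s : ℝ) (_ : t ≤ s), ENNReal.ofReal (s ^ α) * rearr f s

/-- `σ` is an optimal (smallest) rearrangement-invariant target norm for `ρX` in the
Hardy-type inequality `‖∫_t^∞ f(s) s^{m/n-1} ds‖_Y ≤ C ‖f‖_X`. -/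
def IsOptimalTargetNorm (m n : ℕ) (ρX σ : (ℝ → ℝ≥0∞) → ℝ≥0∞) : Prop :=
  (∃ C : ℝ≥0∞, 0 < C ∧ C < ∞ ∧
      ∀ f : ℝ → ℝ≥0∞, Measurable f → σ (hardyOp m n f) ≤ C * ρX f) ∧
  ∀ ρZ : (ℝ → ℝ≥0∞) → ℝ≥0∞, IsRINorm ρZ →
    (∃ C : ℝ≥0∞, 0 < C ∧ C < ∞ ∧
       ∀ f : ℝ → ℝ≥0∞, Measurable f → ρZ (hardyOp m n f) ≤ C * ρX f) →
    ∃ c : ℝ≥0∞, 0 < c ∧ c < ∞ ∧ ∀ f : ℝ → ℝ≥0∞, Measurable f → ρZ f ≤ c * σ f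

/-- There exists a rearrangement-invariant target norm for `ρX` in the Hardy-type
inequality. -/
def ExistsRITarget (m n : ℕ) (ρX : (ℝ → ℝ≥0∞) → ℝ≥0∞) : Prop :=
  ∃ (ρY : (ℝ → ℝ≥0∞) → ℝ≥0∞) (C : ℝ≥0∞), IsRINorm ρY ∧ 0 < C ∧ C < ∞ ∧
    ∀ f : ℝ → ℝ≥0∞, Measurable f → ρY (hardyOp m n f) ≤ C * ρX f

/-- There exists a rearrangement-invariant domain norm for `ρY` in the Hardy-type
inequality. -/
def ExistsRIDomain (m n : ℕ) (ρY : (ℝ → ℝ≥0∞) → ℝ≥0∞) : Prop :=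
  ∃ (ρX : (ℝ → ℝ≥0∞) → ℝ≥0∞) (C : ℝ≥0∞), IsRINorm ρX ∧ 0 < C ∧ C < ∞ ∧
    ∀ f : ℝ → ℝ≥0∞, Measurable f → ρY (hardyOp m n f) ≤ C * ρX f

/-- Two functionals are equivalent with constants independent of the function. -/
def EquivNorms (σ τ : (ℝ → ℝ≥0∞) → ℝ≥0∞) : Prop :=
  ∃ c C : ℝ≥0∞, 0 < c ∧ c < ∞ ∧ 0 < C ∧ C < ∞ ∧
    ∀ f : ℝ → ℝ≥0∞, Measurable f → c * σ f ≤ τ f ∧ τ f ≤ C * σ f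

/-- The decay condition defining `V_0^m X(ℝ^n)`: all derivatives of order `< m` have
finite-measure superlevel sets. -/
def DecaysAtInfinity (n m : ℕ) (u : EuclideanSpace ℝ (Fin n) → ℝ) : Prop :=
  ∀ k : ℕ, k < m → ∀ lam : ℝ, 0 < lam →
    volume {x : EuclideanSpace ℝ (Fin n) | lam < ‖iteratedFDeriv ℝ k u x‖} < ∞

/-- Broken logarithm `ℓ^{[a₀,a_∞]}`. -/
def ell (a0 ai : ℝ) (t : ℝ) : ℝ :=
  if t < 1 then (1 - Real.log t) ^ a0 else (1 + Real.log t) ^ ai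

/-- Doubly broken logarithm `ℓℓ^{[b₀,b_∞]}`. -/
def ell2 (b0 bi : ℝ) (t : ℝ) : ℝ :=
  if t < 1 then (1 + Real.log (1 - Real.log t)) ^ b0
  else (1 + Real.log (1 + Real.log t)) ^ bi

/-- Triply broken logarithm `ℓℓℓ^{[c₀,c_∞]}`. -/
def ell3 (c0 ci : ℝ) (t : ℝ) : ℝ :=
  if t < 1 then (1 + Real.log (1 + Real.log (1 - Real.log t))) ^ c0
  else (1 + Real.log (1 + Real.log (1 + Real.log t))) ^ ci

/-- `L^q`-functional (`q ∈ [1,∞]`) of an `ℝ≥0∞`-valued function over `S ⊆ ℝ`. -/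
def Lqnorm (q : ℝ≥0∞) (S : Set ℝ) (g : ℝ → ℝ≥0∞) : ℝ≥0∞ :=
  if q = ∞ then essSup g (volume.restrict S)
  else (∫⁻ t in S, g t ^ q.toReal) ^ (1 / q.toReal)

/-- Lorentz–Zygmund functional `‖f‖_{p,q;[a₀,a_∞]}`, parametrized by `pinv = 1/p`. -/
def LZnorm (pinv : ℝ) (q : ℝ≥0∞) (a0 ai : ℝ) (f : ℝ → ℝ≥0∞) : ℝ≥0∞ :=
  Lqnorm q (Set.Ioi 0)
    (fun t => ENNReal.ofReal (t ^ (pinv - q⁻¹.toReal) * ell a0 ai t) * rearr f t)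

/-- Generalized Lorentz–Zygmund functional with two tiers of logarithms. -/
def GLZnorm2 (pinv : ℝ) (q : ℝ≥0∞) (a0 ai b0 bi : ℝ) (f : ℝ → ℝ≥0∞) : ℝ≥0∞ :=
  Lqnorm q (Set.Ioi 0)
    (fun t => ENNReal.ofReal (t ^ (pinv - q⁻¹.toReal) * ell a0 ai t * ell2 b0 bi t) * rearr f t)

/-- Generalized Lorentz–Zygmund functional with three tiers of logarithms. -/
def GLZnorm3 (pinv : ℝ) (q : ℝ≥0∞) (a0 ai b0 bi c0 ci : ℝ) (f : ℝ → ℝ≥0∞) : ℝ≥0∞ :=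
  Lqnorm q (Set.Ioi 0)
    (fun t => ENNReal.ofReal
      (t ^ (pinv - q⁻¹.toReal) * ell a0 ai t * ell2 b0 bi t * ell3 c0 ci t) * rearr f t)

/-- Young function predicate. -/
structure IsYoung (A : ℝ → ℝ≥0∞) : Prop where
  map_zero : A 0 = 0
  convex : ∀ x y : ℝ, 0 ≤ x → 0 ≤ y → ∀ l : ℝ, 0 ≤ l → l ≤ 1 →
    A (l * x + (1 - l) * y) ≤ ENNReal.ofReal l * A x + ENNReal.ofReal (1 - l) * A y
  left_cont : ∀ x : ℝ, 0 < x → Filter.Tendsto A (nhdsWithin x (Set.Iio x)) (nhds (A x))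
  not_zero : ∃ x : ℝ, 0 < x ∧ A x ≠ 0
  not_top : ∃ x : ℝ, 0 < x ∧ A x ≠ ∞

/-- Canonical extension of a Young function to `ℝ≥0∞`-valued arguments. -/
def eext (A : ℝ → ℝ≥0∞) (x : ℝ≥0∞) : ℝ≥0∞ := if x = ∞ then ∞ else A x.toReal

/-- Luxemburg norm on `(0,∞)`. -/
def luxNorm (A : ℝ → ℝ≥0∞) (f : ℝ → ℝ≥0∞) : ℝ≥0∞ :=
  sInf {l : ℝ≥0∞ | l ≠ 0 ∧ (∫⁻ t in Set.Ioi (0:ℝ), eext A (f t / l)) ≤ 1}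

/-- Generalized (right-continuous) inverse of a nondecreasing `g : ℝ → ℝ≥0∞`. -/
def geninv (g : ℝ → ℝ≥0∞) (y : ℝ≥0∞) : ℝ≥0∞ :=
  ⨅ (s : ℝ) (_ : 0 ≤ s) (_ : y ≤ g s), ENNReal.ofReal s

/-- Young conjugate `Ã(t) = sup_{s ≥ 0} (st - A(s))`. -/
def conjY (A : ℝ → ℝ≥0∞) (t : ℝ) : ℝ≥0∞ :=
  ⨆ (s : ℝ) (_ : 0 ≤ s), (ENNReal.ofReal (s * t) - A s)

/-- `h_A(t) = sup_{0<s<∞} A^{-1}(st)/A^{-1}(s)`. -/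
def hYoung (A : ℝ → ℝ≥0∞) (t : ℝ) : ℝ≥0∞ :=
  ⨆ (s : ℝ) (_ : 0 < s), geninv A (ENNReal.ofReal (s * t)) / geninv A (ENNReal.ofReal s)

/-- The upper Boyd index `I_A = inf_{0<t<1} log t / log h_A(t)`. -/
def upperBoyd (A : ℝ → ℝ≥0∞) : ℝ :=
  sInf ((fun t => Real.log t / Real.log ((hYoung A t).toReal)) '' Set.Ioo (0:ℝ) 1)

/-- `H_m(t) = (∫_0^t (s/A(s))^{m/(n-m)} ds)^{(n-m)/n}`. -/
def Hm (m n : ℕ) (A : ℝ → ℝ≥0∞) (t : ℝ) : ℝ≥0∞ :=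
  (∫⁻ s in Set.Ioc (0:ℝ) t, (ENNReal.ofReal s / A s) ^ ((m : ℝ)/((n : ℝ) - (m : ℝ))))
    ^ (((n : ℝ) - (m : ℝ))/(n : ℝ))

/-- `H^∞ = lim_{t→∞} H_m(t)`. -/
def Hinfty (m n : ℕ) (A : ℝ → ℝ≥0∞) : ℝ≥0∞ := ⨆ t : ℝ, Hm m n A t

/-- `D_m`. -/
def Dm (m n : ℕ) (A : ℝ → ℝ≥0∞) (t : ℝ) : ℝ≥0∞ :=
  if ENNReal.ofReal t < Hinfty m n A then
    (ENNReal.ofReal t * A ((geninv (Hm m n A) (ENNReal.ofReal t)).toReal) /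
        geninv (Hm m n A) (ENNReal.ofReal t)) ^ ((n : ℝ)/((n : ℝ) - (m : ℝ)))
  else ∞

/-- `A_m(t) = ∫_0^t D_m(s)/s ds`. -/
def Am (m n : ℕ) (A : ℝ → ℝ≥0∞) (t : ℝ) : ℝ≥0∞ :=
  ∫⁻ s in Set.Ioc (0:ℝ) t, Dm m n A s / ENNReal.ofReal s

/-- `G_m(t) = t · inf_{0<s≤t} B^{-1}(s) s^{(m-n)/n}`. -/
def Gm (m n : ℕ) (B : ℝ → ℝ≥0∞) (t : ℝ) : ℝ≥0∞ :=
  ENNReal.ofReal t *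
    ⨅ (s : ℝ) (_ : 0 < s) (_ : s ≤ t),
      geninv B (ENNReal.ofReal s) * ENNReal.ofReal (s ^ (((m : ℝ) - (n : ℝ))/(n : ℝ)))

/-- `B_m(t) = ∫_0^t G_m^{-1}(s)/s ds`. -/
def Bm (m n : ℕ) (B : ℝ → ℝ≥0∞) (t : ℝ) : ℝ≥0∞ :=
  ∫⁻ s in Set.Ioc (0:ℝ) t, geninv (Gm m n B) (ENNReal.ofReal s) / ENNReal.ofReal s

/-- `A` dominates `B` near zero. -/
def DomNearZero (A B : ℝ → ℝ≥0∞) : Prop :=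
  ∃ c t0 : ℝ, 0 < c ∧ 0 < t0 ∧ ∀ t : ℝ, 0 ≤ t → t ≤ t0 → B t ≤ A (c * t)

/-- `A` dominates `B` near infinity. -/
def DomNearInfty (A B : ℝ → ℝ≥0∞) : Prop :=
  ∃ c t0 : ℝ, 0 < c ∧ 0 < t0 ∧ ∀ t : ℝ, t0 ≤ t → B t ≤ A (c * t)

def EquivNearZero (A B : ℝ → ℝ≥0∞) : Prop := DomNearZero A B ∧ DomNearZero B A

def EquivNearInfty (A B : ℝ → ℝ≥0∞) : Prop := DomNearInfty A B ∧ DomNearInfty B A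

/-- There exists an Orlicz target for the Hardy-type inequality with domain `L^A`. -/
def ExistsOrliczTarget (m n : ℕ) (A : ℝ → ℝ≥0∞) : Prop :=
  ∃ B : ℝ → ℝ≥0∞, IsYoung B ∧ ∃ C : ℝ≥0∞, 0 < C ∧ C < ∞ ∧
    ∀ f : ℝ → ℝ≥0∞, Measurable f → luxNorm B (hardyOp m n f) ≤ C * luxNorm A f

/-- There exists an Orlicz domain for the Hardy-type inequality with target `L^B`. -/
def ExistsOrliczDomain (m n : ℕ) (B : ℝ → ℝ≥0∞) : Prop :=
  ∃ A : ℝ → ℝ≥0∞, IsYoung A ∧ ∃ C : ℝ≥0∞, 0 < C ∧ C < ∞ ∧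
    ∀ f : ℝ → ℝ≥0∞, Measurable f → luxNorm B (hardyOp m n f) ≤ C * luxNorm A f

/-- `L^{A_m}` is the optimal (smallest) Orlicz target for `L^A`. -/
def IsOptimalOrliczTarget (m n : ℕ) (A B : ℝ → ℝ≥0∞) : Prop :=
  (∃ C : ℝ≥0∞, 0 < C ∧ C < ∞ ∧
      ∀ f : ℝ → ℝ≥0∞, Measurable f → luxNorm B (hardyOp m n f) ≤ C * luxNorm A f) ∧
  ∀ B' : ℝ → ℝ≥0∞, IsYoung B' →
    (∃ C : ℝ≥0∞, 0 < C ∧ C < ∞ ∧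
       ∀ f : ℝ → ℝ≥0∞, Measurable f → luxNorm B' (hardyOp m n f) ≤ C * luxNorm A f) →
    ∃ c : ℝ≥0∞, 0 < c ∧ c < ∞ ∧
      ∀ g : ℝ → ℝ≥0∞, Measurable g → luxNorm B' g ≤ c * luxNorm B g

/-- Model Young-function behaviour `t^p (1 - log t)^a` (near zero). -/
def modelZero (p a : ℝ) (t : ℝ) : ℝ≥0∞ := ENNReal.ofReal (t ^ p * (1 - Real.log t) ^ a)

/-- Model Young-function behaviour `t^p (1 + log t)^a` (near infinity). -/
def modelInf (p a : ℝ) (t : ℝ) : ℝ≥0∞ := ENNReal.ofReal (t ^ p * (1 + Real.log t) ^ a)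



/-- `1 + |log t|`. -/
def LL (t : ℝ) : ℝ := 1 + |Real.log t|

/-- power-log function `t^a (1+|log t|)^b`. -/
def PL (a b t : ℝ) : ℝ := t ^ a * LL t ^ b

lemma LL_one_le (t : ℝ) : 1 ≤ LL t := by
  unfold LL; linarith [abs_nonneg (Real.log t)]

lemma LL_pos (t : ℝ) : 0 < LL t := by linarith [LL_one_le t]

lemma LL_inv (t : ℝ) : LL t⁻¹ = LL t := by simp [LL]

lemma LL_mul_le {c t : ℝ} (hc : 0 < c) (ht : 0 < t) : LL (c * t) ≤ LL c * LL t := by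
  unfold LL
  rw [Real.log_mul hc.ne' ht.ne']
  nlinarith [abs_add_le (Real.log c) (Real.log t), abs_nonneg (Real.log c),
    abs_nonneg (Real.log t), mul_nonneg (abs_nonneg (Real.log c)) (abs_nonneg (Real.log t))]

lemma PL_pos {a b t : ℝ} (ht : 0 < t) : 0 < PL a b t :=
  mul_pos (Real.rpow_pos_of_pos ht _) (Real.rpow_pos_of_pos (LL_pos t) _)

/-- if two quantities `≥` are comparable up to `K`, so are their powers -/
lemma rpow_cmp {x y K : ℝ} (hx : 0 < x) (hy : 0 < y) (h1 : x ≤ K * y)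
    (h2 : y ≤ K * x) (b : ℝ) : x ^ b ≤ K ^ |b| * y ^ b := by
  have hK0 : 0 < K := by
    by_contra h
    nlinarith
  rcases le_total 0 b with hb | hb
  · rw [abs_of_nonneg hb, ← Real.mul_rpow hK0.le hy.le]
    exact Real.rpow_le_rpow hx.le h1 hb
  · rw [abs_of_nonpos hb]
    have h3 : y / K ≤ x := by rw [div_le_iff₀ hK0]; linarith
    have := Real.rpow_le_rpow_of_nonpos (div_pos hy hK0) h3 hb
    refine this.trans (le_of_eq ?_)
    rw [Real.div_rpow hy.le hK0.le, Real.rpow_neg hK0.le]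
    field_simp

lemma LL_rpow_mul_le {c t : ℝ} (hc : 0 < c) (ht : 0 < t) (b : ℝ) :
    LL (c * t) ^ b ≤ LL c ^ |b| * LL t ^ b := by
  refine rpow_cmp (LL_pos _) (LL_pos _) (LL_mul_le hc ht) ?_ b
  have := LL_mul_le (inv_pos.2 hc) (mul_pos hc ht)
  rwa [LL_inv, inv_mul_cancel_left₀ hc.ne'] at this

lemma PL_mul_le {c t : ℝ} (hc : 0 < c) (ht : 0 < t) (a b : ℝ) :
    PL a b (c * t) ≤ PL a |b| c * PL a b t := by
  unfold PL
  rw [Real.mul_rpow hc.le ht.le]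
  have := LL_rpow_mul_le hc ht b
  have h1 := (Real.rpow_pos_of_pos hc a)
  have h2 := (Real.rpow_pos_of_pos ht a)
  calc _ ≤ c ^ a * t ^ a * (LL c ^ |b| * LL t ^ b) := by gcongr
    _ = _ := by ring

lemma PL_mul_ge {c t : ℝ} (hc : 0 < c) (ht : 0 < t) (a b : ℝ) :
    PL a (-|b|) c * PL a b t ≤ PL a b (c * t) := by
  have h := PL_mul_le (inv_pos.2 hc) (mul_pos hc ht) a b
  rw [inv_mul_cancel_left₀ hc.ne'] at h
  have h2 : PL a (-|b|) c * PL a |b| c⁻¹ = 1 := by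
    unfold PL
    rw [LL_inv, Real.inv_rpow hc.le, Real.rpow_neg (LL_pos c).le]
    have h1 := (Real.rpow_pos_of_pos hc a).ne'
    have h2 := (Real.rpow_pos_of_pos (LL_pos c) |b|).ne'
    field_simp
  calc _ ≤ PL a (-|b|) c * (PL a |b| c⁻¹ * PL a b (c * t)) := by
        gcongr; exact (PL_pos hc).le
    _ = _ := by rw [← mul_assoc, h2, one_mul]

lemma LL_rpow_le_exp (b : ℝ) {d : ℝ} (hd : 0 < d) :
    ∃ C : ℝ, 0 < C ∧ ∀ t : ℝ, LL t ^ b ≤ C * Real.exp (d * |Real.log t|) := by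
  set e : ℝ := min 1 (d / (|b| + 1)) with he
  have hb : 0 ≤ |b| := abs_nonneg b
  have he0 : 0 < e := lt_min one_pos (by positivity)
  have he1 : e ≤ 1 := min_le_left _ _
  have heb : e * |b| ≤ d := by
    have h2 : e ≤ d / (|b| + 1) := min_le_right _ _
    rw [le_div_iff₀ (by positivity)] at h2
    nlinarith
  refine ⟨(e⁻¹) ^ |b|, by positivity, fun t => ?_⟩
  have hx : 0 ≤ |Real.log t| := abs_nonneg _
  have h1 : LL t ≤ e⁻¹ * Real.exp (e * |Real.log t|) := by
    rw [inv_mul_eq_div, le_div_iff₀ he0]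
    unfold LL
    nlinarith [Real.add_one_le_exp (e * |Real.log t|)]
  calc LL t ^ b ≤ LL t ^ |b| := Real.rpow_le_rpow_of_exponent_le (LL_one_le t) (le_abs_self b)
    _ ≤ (e⁻¹ * Real.exp (e * |Real.log t|)) ^ |b| :=
        Real.rpow_le_rpow (LL_pos t).le h1 hb
    _ = (e⁻¹) ^ |b| * Real.exp (e * |b| * |Real.log t|) := by
        rw [Real.mul_rpow (by positivity) (by positivity), ← Real.exp_mul]
        ring_nf
    _ ≤ _ := by
        have : e * |b| * |Real.log t| ≤ d * |Real.log t| := by gcongr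
        have := Real.exp_le_exp.2 this
        gcongr

lemma exp_abs_log_of_le_one {t d : ℝ} (ht : 0 < t) (h1 : t ≤ 1) :
    Real.exp (d * |Real.log t|) = t ^ (-d) := by
  rw [abs_of_nonpos (Real.log_nonpos ht.le h1), Real.rpow_def_of_pos ht]; ring_nf

lemma exp_abs_log_of_one_le {t d : ℝ} (h1 : 1 ≤ t) :
    Real.exp (d * |Real.log t|) = t ^ d := by
  rw [abs_of_nonneg (Real.log_nonneg h1), Real.rpow_def_of_pos (by linarith)]; ring_nf

lemma PL_tendsto_zero {a : ℝ} (ha : 0 < a) (b : ℝ) :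
    Tendsto (PL a b) (𝓝[>] 0) (𝓝[>] 0) := by
  obtain ⟨C, hC, h⟩ := LL_rpow_le_exp b (half_pos ha)
  have h0 : ∀ᶠ t : ℝ in 𝓝[>] 0, t ∈ Ioo (0:ℝ) 1 := Ioo_mem_nhdsGT one_pos
  refine tendsto_nhdsWithin_iff.2 ⟨?_, h0.mono fun t ht => PL_pos ht.1⟩
  have hlim : Tendsto (fun t : ℝ => C * t ^ (a/2)) (𝓝[>] 0) (𝓝 0) := by
    have := ((Real.continuousAt_rpow_const 0 (a/2) (Or.inr (by positivity))).tendsto.const_mul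
      C).mono_left (nhdsWithin_le_nhds (s := Ioi (0:ℝ)))
    simpa [Real.zero_rpow (by positivity : a/2 ≠ 0)] using this
  refine tendsto_of_tendsto_of_tendsto_of_le_of_le' tendsto_const_nhds hlim
    (h0.mono fun t ht => (PL_pos ht.1).le) (h0.mono fun t ht => ?_)
  have := h t
  rw [exp_abs_log_of_le_one ht.1 ht.2.le] at this
  have h1 := (Real.rpow_pos_of_pos ht.1 a)
  calc PL a b t ≤ t ^ a * (C * t ^ (-(a/2))) := by unfold PL; gcongr
    _ = C * (t ^ a * t ^ (-(a/2))) := by ring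
    _ = _ := by rw [← Real.rpow_add ht.1]; ring_nf

lemma PL_tendsto_atTop {a : ℝ} (ha : 0 < a) (b : ℝ) :
    Tendsto (PL a b) atTop atTop := by
  obtain ⟨C, hC, h⟩ := LL_rpow_le_exp (-b) (half_pos ha)
  have hlim : Tendsto (fun t : ℝ => C⁻¹ * t ^ (a/2)) atTop atTop :=
    (tendsto_rpow_atTop (half_pos ha)).const_mul_atTop (inv_pos.2 hC)
  refine tendsto_atTop_mono' _ ?_ hlim
  filter_upwards [eventually_ge_atTop 1] with t ht
  have ht0 : 0 < t := by linarith
  have := h t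
  rw [exp_abs_log_of_one_le ht, Real.rpow_neg (LL_pos t).le] at this
  have hl := Real.rpow_pos_of_pos (LL_pos t) b
  have h2 : t ^ a = t ^ (a/2) * t ^ (a/2) := by rw [← Real.rpow_add ht0]; ring_nf
  have h3 := Real.rpow_pos_of_pos ht0 (a/2)
  unfold PL
  rw [h2, inv_mul_eq_div, div_le_iff₀ hC]
  have h4 : 1 ≤ C * t ^ (a/2) * LL t ^ b := by
    rwa [inv_le_iff_one_le_mul₀ hl] at this
  nlinarith

lemma LL_PL_le {a : ℝ} (ha : 0 < a) (b : ℝ) {t : ℝ} (ht : 0 < t) :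
    LL (PL a b t) ≤ (1 + a + |b|) * LL t := by
  have h1 : Real.log (PL a b t) = a * Real.log t + b * Real.log (LL t) := by
    unfold PL
    rw [Real.log_mul (Real.rpow_pos_of_pos ht _).ne' (Real.rpow_pos_of_pos (LL_pos t) _).ne',
      Real.log_rpow ht, Real.log_rpow (LL_pos t)]
  have h2 : |Real.log (LL t)| ≤ |Real.log t| := by
    rw [abs_of_nonneg (Real.log_nonneg (LL_one_le t))]
    have := Real.log_le_sub_one_of_pos (LL_pos t)
    unfold LL at this ⊢; linarith
  have h3 : |Real.log (PL a b t)| ≤ a * |Real.log t| + |b| * |Real.log t| := by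
    rw [h1]
    refine (abs_add_le _ _).trans ?_
    rw [abs_mul, abs_mul, abs_of_pos ha]
    gcongr
  have hx := abs_nonneg (Real.log t)
  have hb := abs_nonneg b
  unfold LL at *
  nlinarith

lemma le_LL_PL {a : ℝ} (ha : 0 < a) (b : ℝ) :
    ∃ C : ℝ, 0 < C ∧ ∀ t : ℝ, 0 < t → LL t ≤ C * LL (PL a b t) := by
  obtain ⟨C, hC, h⟩ := LL_rpow_le_exp |b| (half_pos ha)
  refine ⟨1 + 2 / a * (1 + |Real.log C|), by positivity, fun t ht => ?_⟩
  have h1 : Real.log (PL a b t) = a * Real.log t + b * Real.log (LL t) := by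
    unfold PL
    rw [Real.log_mul (Real.rpow_pos_of_pos ht _).ne' (Real.rpow_pos_of_pos (LL_pos t) _).ne',
      Real.log_rpow ht, Real.log_rpow (LL_pos t)]
  have h2 : |b| * Real.log (LL t) ≤ Real.log C + a / 2 * |Real.log t| := by
    have := Real.log_le_log (Real.rpow_pos_of_pos (LL_pos t) _) (h t)
    rwa [Real.log_rpow (LL_pos t), Real.log_mul hC.ne' (Real.exp_pos _).ne',
      Real.log_exp] at this
  have h3 : a * |Real.log t| ≤ |Real.log (PL a b t)| + |b| * Real.log (LL t) := by
    have h4 : a * Real.log t = Real.log (PL a b t) - b * Real.log (LL t) := by linarith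
    have h5 : |a * Real.log t| ≤ |Real.log (PL a b t)| + |b * Real.log (LL t)| := by
      rw [h4]; exact abs_sub _ _
    rwa [abs_mul, abs_mul, abs_of_pos ha,
      abs_of_nonneg (Real.log_nonneg (LL_one_le t))] at h5
  have h6 : |Real.log t| ≤ 2 / a * (|Real.log (PL a b t)| + |Real.log C|) := by
    rw [div_mul_eq_mul_div, le_div_iff₀ ha]
    linarith [le_abs_self (Real.log C)]
  have hx := abs_nonneg (Real.log C)
  have hy := abs_nonneg (Real.log (PL a b t))
  have ha' : 0 ≤ 2 / a := by positivity
  unfold LL at *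
  have h7 : 2 / a * (|Real.log (PL a b t)| + |Real.log C|)
     ≤ 2 / a * ((1 + |Real.log C|) * (1 + |Real.log (PL a b t)|)) := by
    gcongr; nlinarith
  nlinarith

lemma PL_comp {a : ℝ} (ha : 0 < a) (b : ℝ) :
    ∃ K : ℝ, 0 < K ∧ ∀ y : ℝ, 0 < y →
      y ≤ K * PL a b (PL (1/a) (-b/a) y) ∧ PL a b (PL (1/a) (-b/a) y) ≤ K * y := by
  have ha' : 0 < 1 / a := by positivity
  obtain ⟨C, hC, h⟩ := le_LL_PL ha' (-b/a)
  set D : ℝ := max C (1 + 1/a + |-b/a|) with hD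
  have hD0 : 0 < D := lt_max_of_lt_left hC
  refine ⟨D ^ |b|, by positivity, fun y hy => ?_⟩
  set t := PL (1/a) (-b/a) y with ht
  have ht0 : 0 < t := PL_pos hy
  have h1 : t ^ a = y * LL y ^ (-b) := by
    rw [ht]; unfold PL
    rw [Real.mul_rpow (by positivity) (Real.rpow_pos_of_pos (LL_pos y) _).le,
      ← Real.rpow_mul hy.le, ← Real.rpow_mul (LL_pos y).le]
    have e1 : 1 / a * a = 1 := by field_simp
    have e2 : -b / a * a = -b := by field_simp
    rw [e1, e2, Real.rpow_one]
  have h2 : LL y ≤ D * LL t :=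
    (h y hy).trans (mul_le_mul_of_nonneg_right (le_max_left _ _) (LL_pos _).le)
  have h3 : LL t ≤ D * LL y :=
    (LL_PL_le ha' _ hy).trans (mul_le_mul_of_nonneg_right (le_max_right _ _) (LL_pos _).le)
  have h4 := rpow_cmp (LL_pos y) (LL_pos t) h2 h3 b
  have h5 := rpow_cmp (LL_pos t) (LL_pos y) h3 h2 b
  have hy' := Real.rpow_pos_of_pos (LL_pos y) b
  have h6 : PL a b t = y * (LL t ^ b / LL y ^ b) := by
    unfold PL; rw [h1, Real.rpow_neg (LL_pos y).le]; field_simp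
  rw [h6]
  constructor
  · have : 1 ≤ D ^ |b| * (LL t ^ b / LL y ^ b) := by
      rw [← mul_div_assoc, le_div_iff₀ hy']; linarith
    nlinarith
  · rw [mul_comm]; gcongr; rw [div_le_iff₀ hy']; exact h5

lemma inv_upper {a : ℝ} (ha : 0 < a) (b : ℝ) {c : ℝ} (hc : 0 < c) :
    ∃ C : ℝ, 0 < C ∧ ∀ y : ℝ, 0 < y → y ≤ c * PL a b (C * PL (1/a) (-b/a) y) := by
  obtain ⟨K, hK, h⟩ := PL_comp ha b
  obtain ⟨C, hC0, hC⟩ := ((eventually_gt_atTop 0).and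
    ((PL_tendsto_atTop ha (-|b|)).eventually_ge_atTop (K / c))).exists
  refine ⟨C, hC0, fun y hy => ?_⟩
  have h1 := PL_mul_ge hC0 (PL_pos (a := 1/a) (b := -b/a) hy) a b
  have h2 := (h y hy).1
  have h3 := PL_pos (a := a) (b := b) (PL_pos (a := 1/a) (b := -b/a) hy)
  rw [div_le_iff₀ hc] at hC
  calc y ≤ K * PL a b (PL (1/a) (-b/a) y) := h2
    _ ≤ (PL a (-|b|) C * c) * PL a b (PL (1/a) (-b/a) y) := by gcongr
    _ = c * (PL a (-|b|) C * PL a b (PL (1/a) (-b/a) y)) := by ring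
    _ ≤ _ := by gcongr

lemma inv_lower {a : ℝ} (ha : 0 < a) (b : ℝ) {C : ℝ} (hC : 0 < C) :
    ∃ c : ℝ, 0 < c ∧ ∀ y : ℝ, 0 < y → C * PL a b (c * PL (1/a) (-b/a) y) < y := by
  obtain ⟨K, hK, h⟩ := PL_comp ha b
  have hlim := (PL_tendsto_zero ha (|b|)).mono_right nhdsWithin_le_nhds
  obtain ⟨c, hc0, hc⟩ := ((self_mem_nhdsWithin : Ioi (0:ℝ) ∈ 𝓝[>] (0:ℝ)) |> fun hh =>
    (show ∀ᶠ x : ℝ in 𝓝[>] 0, 0 < x from hh).and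
      (hlim.eventually (gt_mem_nhds (by positivity : 0 < 1 / (C * K))))).exists
  refine ⟨c, hc0, fun y hy => ?_⟩
  have h1 := PL_mul_le hc0 (PL_pos (a := 1/a) (b := -b/a) hy) a b
  have h2 := (h y hy).2
  rw [lt_div_iff₀ (by positivity)] at hc
  calc C * PL a b (c * PL (1/a) (-b/a) y)
      ≤ C * (PL a |b| c * (K * y)) := by
        have := (PL_pos (a := a) (b := |b|) hc0).le
        gcongr
        exact h1.trans (by gcongr)
    _ = (PL a |b| c * (C * K)) * y := by ring
    _ < 1 * y := by gcongr
    _ = y := one_mul y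

/-- almost monotonicity -/
lemma PL_almost_anti {g : ℝ} (hg : 0 < g) (b : ℝ) :
    ∃ C : ℝ, 0 < C ∧ ∀ s t : ℝ, 0 < s → s ≤ t → PL (-g) b t ≤ C * PL (-g) b s := by
  obtain ⟨C, hC, h⟩ := LL_rpow_le_exp |b| hg
  refine ⟨C, hC, fun s t hs hst => ?_⟩
  have hr : 1 ≤ t / s := by rwa [one_le_div hs]
  have hr0 : 0 < t / s := by linarith
  have e : t = t / s * s := by field_simp
  have h1 := PL_mul_le hr0 hs (-g) b
  rw [← e] at h1
  refine h1.trans ?_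
  have := PL_pos (a := -g) (b := b) hs
  gcongr
  unfold PL
  have h2 := h (t / s)
  rw [exp_abs_log_of_one_le hr] at h2
  have h3 := Real.rpow_pos_of_pos hr0 g
  rw [Real.rpow_neg hr0.le, inv_mul_le_iff₀ h3]; linarith


lemma young_scale {B : ℝ → ℝ≥0∞} (hB : IsYoung B) {l y : ℝ} (hl : 0 ≤ l) (hl1 : l ≤ 1)
    (hy : 0 ≤ y) : B (l * y) ≤ ENNReal.ofReal l * B y := by
  have := hB.convex y 0 hy le_rfl l hl hl1
  simpa [hB.map_zero] using this

lemma young_mono {B : ℝ → ℝ≥0∞} (hB : IsYoung B) {x y : ℝ} (hx : 0 ≤ x) (hxy : x ≤ y) :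
    B x ≤ B y := by
  rcases hx.eq_or_lt with rfl | hx
  · simp [hB.map_zero]
  have hy : 0 < y := hx.trans_le hxy
  have h1 : x / y ≤ 1 := by rw [div_le_one hy]; exact hxy
  have h := young_scale hB (by positivity : 0 ≤ x / y) h1 hy.le
  rw [div_mul_cancel₀ _ hy.ne'] at h
  exact h.trans (mul_le_of_le_one_left' (by simpa using h1))

lemma young_strict {B : ℝ → ℝ≥0∞} (hB : IsYoung B) (hpos : ∀ x, 0 < x → B x ≠ 0)
    (hfin : ∀ x, 0 ≤ x → B x ≠ ∞) {x y : ℝ} (hx : 0 ≤ x) (hxy : x < y) :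
    B x < B y := by
  have hy : 0 < y := hx.trans_lt hxy
  have h1 : x / y < 1 := by rw [div_lt_one hy]; exact hxy
  have h := young_scale hB (by positivity : 0 ≤ x / y) h1.le hy.le
  rw [div_mul_cancel₀ _ hy.ne'] at h
  refine h.trans_lt ?_
  calc ENNReal.ofReal (x / y) * B y < 1 * B y := by
        rw [ENNReal.mul_lt_mul_iff_left (hpos y hy) (hfin y hy.le)]
        simpa using h1
    _ = B y := one_mul _

lemma geninv_le {g : ℝ → ℝ≥0∞} {y : ℝ≥0∞} {s : ℝ} (hs : 0 ≤ s) (h : y ≤ g s) :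
    geninv g y ≤ ENNReal.ofReal s := iInf_le_of_le s (iInf_le_of_le hs (iInf_le _ h))

lemma geninv_mono (g : ℝ → ℝ≥0∞) {y z : ℝ≥0∞} (h : y ≤ z) : geninv g y ≤ geninv g z :=
  le_iInf fun _ => le_iInf fun hs => le_iInf fun hz => geninv_le hs (h.trans hz)

/-- lower bound of the inverse of a Young function -/
lemma young_le_geninv {B : ℝ → ℝ≥0∞} (hB : IsYoung B) (hpos : ∀ x, 0 < x → B x ≠ 0)
    (hfin : ∀ x, 0 ≤ x → B x ≠ ∞) {w : ℝ} {y : ℝ≥0∞} (h : B w ≤ y) :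
    ENNReal.ofReal w ≤ geninv B y := by
  refine le_iInf fun s => le_iInf fun hs => le_iInf fun hy => ENNReal.ofReal_le_ofReal ?_
  by_contra hlt
  push Not at hlt
  exact absurd (h.trans hy) (not_le.2 (young_strict hB hpos hfin hs hlt))

/-- `w < B⁻¹(y)` implies `B w < y` -/
lemma lt_of_lt_geninv {B : ℝ → ℝ≥0∞} {w : ℝ} (hw : 0 ≤ w) {y : ℝ≥0∞}
    (h : ENNReal.ofReal w < geninv B y) : B w < y := by
  by_contra hc
  push Not at hc
  exact absurd h (not_lt.2 (geninv_le hw hc))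

lemma Gm_le {m n : ℕ} {B : ℝ → ℝ≥0∞} {r u : ℝ} (hr : 0 < r) (hru : r ≤ u) :
    Gm m n B u ≤ ENNReal.ofReal u * (geninv B (ENNReal.ofReal r) *
      ENNReal.ofReal (r ^ (((m : ℝ) - (n : ℝ))/(n : ℝ)))) := by
  unfold Gm
  gcongr
  exact iInf_le_of_le r (iInf_le_of_le hr (iInf_le _ hru))

lemma le_Gm {m n : ℕ} {B : ℝ → ℝ≥0∞} {u : ℝ} (hu : 0 < u) {x : ℝ≥0∞}
    (h : ∀ r, 0 < r → r ≤ u → x ≤ ENNReal.ofReal u * (geninv B (ENNReal.ofReal r) *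
      ENNReal.ofReal (r ^ (((m : ℝ) - (n : ℝ))/(n : ℝ))))) : x ≤ Gm m n B u := by
  unfold Gm
  have h0 : ENNReal.ofReal u ≠ 0 := by simpa using hu
  simp only [ENNReal.mul_iInf_of_ne h0 ENNReal.ofReal_ne_top]
  exact le_iInf fun r => le_iInf fun hr => le_iInf fun hru => h r hr hru

lemma Gm_nonpos {m n : ℕ} {B : ℝ → ℝ≥0∞} {u : ℝ} (hu : u ≤ 0) : Gm m n B u = 0 := by
  unfold Gm; rw [ENNReal.ofReal_of_nonpos hu, zero_mul]

lemma exp_eq {m n : ℕ} (hmn : m < n) : ((m : ℝ) - (n : ℝ))/(n : ℝ) = (m:ℝ)/n - 1 := by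
  have : (n:ℝ) ≠ 0 := by
    have : 0 < n := by omega
    positivity
  field_simp

lemma Gm_mono {m n : ℕ} (hmn : m < n) {B : ℝ → ℝ≥0∞} {u w : ℝ} (huw : u ≤ w) :
    Gm m n B u ≤ Gm m n B w := by
  rcases le_or_gt u 0 with hu | hu
  · rw [Gm_nonpos hu]; exact zero_le
  refine le_Gm (hu.trans_le huw) fun r hr hrw => ?_
  rcases le_total r u with h | h
  · refine (Gm_le hr h).trans ?_
    gcongr
  · refine (Gm_le hu le_rfl).trans ?_
    have key : ∀ v : ℝ, 0 < v → ENNReal.ofReal v * (geninv B (ENNReal.ofReal v) *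
      ENNReal.ofReal (v ^ (((m : ℝ) - (n : ℝ))/(n : ℝ)))) = geninv B (ENNReal.ofReal v) *
        ENNReal.ofReal (v ^ ((m:ℝ)/n)) := by
      intro v hv
      rw [mul_left_comm, ← ENNReal.ofReal_mul hv.le, exp_eq hmn]
      congr 2
      nth_rewrite 1 [← Real.rpow_one v]
      rw [← Real.rpow_add hv]; ring_nf
    calc _ = _ := key u hu
      _ ≤ geninv B (ENNReal.ofReal r) * ENNReal.ofReal (r ^ ((m:ℝ)/n)) := by
        gcongr
        exact geninv_mono _ (ENNReal.ofReal_le_ofReal h)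
      _ = _ := (key r hr).symm
      _ ≤ _ := by gcongr

lemma Gm_scale {m n : ℕ} {B : ℝ → ℝ≥0∞} {l u : ℝ} (hl : 1 ≤ l) :
    Gm m n B (l * u) ≤ ENNReal.ofReal l * Gm m n B u := by
  rcases le_or_gt u 0 with hu | hu
  · rw [Gm_nonpos (by nlinarith)]; exact zero_le
  unfold Gm
  rw [ENNReal.ofReal_mul (by linarith), mul_assoc]
  refine mul_le_mul_right (mul_le_mul_right ?_ _) _
  refine le_iInf fun s => le_iInf fun hs => le_iInf fun hsu => ?_
  exact iInf_le_of_le s (iInf_le_of_le hs (iInf_le _ (by nlinarith)))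

lemma Bm_upper {m n : ℕ} {B : ℝ → ℝ≥0∞} {x w : ℝ} (hx : 0 < x)
    (hw : 0 ≤ w) (h : ENNReal.ofReal x ≤ Gm m n B w) : Bm m n B x ≤ ENNReal.ofReal w := by
  unfold Bm
  calc _ ≤ ∫⁻ s in Set.Ioc (0:ℝ) x, ENNReal.ofReal (w / x) := by
        refine setLIntegral_mono' measurableSet_Ioc fun s hs => ?_
        have hs0 : 0 < s := hs.1
        have h1 : geninv (Gm m n B) (ENNReal.ofReal s) ≤ ENNReal.ofReal (s / x * w) := by
          refine geninv_le (by positivity) ?_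
          have h2 := Gm_scale (m := m) (n := n) (B := B) (l := x / s) (u := s / x * w)
            (by rw [one_le_div hs0]; exact hs.2)
          have e : x / s * (s / x * w) = w := by field_simp
          rw [e] at h2
          calc ENNReal.ofReal s = ENNReal.ofReal (s / x) * ENNReal.ofReal x := by
                rw [← ENNReal.ofReal_mul (by positivity), div_mul_cancel₀ _ hx.ne']
            _ ≤ ENNReal.ofReal (s / x) * (ENNReal.ofReal (x / s) * Gm m n B (s / x * w)) := by
                gcongr; exact h.trans h2
            _ = _ := by
                rw [← mul_assoc, ← ENNReal.ofReal_mul (by positivity)]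
                have : s / x * (x / s) = 1 := by field_simp
                rw [this]; simp
        refine ENNReal.div_le_of_le_mul (h1.trans (le_of_eq ?_))
        rw [← ENNReal.ofReal_mul (by positivity)]
        congr 1; field_simp
    _ = ENNReal.ofReal w := by
        rw [setLIntegral_const, Real.volume_Ioc, ← ENNReal.ofReal_mul (by positivity)]
        congr 1; field_simp; ring

lemma Bm_lower {m n : ℕ} (hmn : m < n) {B : ℝ → ℝ≥0∞} {x z u : ℝ} (hz : 0 < z)
    (hu : 0 ≤ u) (hzx : z ≤ x) (h : Gm m n B u < ENNReal.ofReal z) :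
    ENNReal.ofReal ((x - z) * (u / z)) ≤ Bm m n B x := by
  unfold Bm
  calc ENNReal.ofReal ((x - z) * (u / z)) = ∫⁻ s in Set.Ioc z x, ENNReal.ofReal (u / z) := by
        rw [setLIntegral_const, Real.volume_Ioc, ← ENNReal.ofReal_mul (by positivity), mul_comm]
    _ ≤ ∫⁻ s in Set.Ioc z x, geninv (Gm m n B) (ENNReal.ofReal s) / ENNReal.ofReal s := by
        refine setLIntegral_mono' measurableSet_Ioc fun s hs => ?_
        have hs0 : 0 < s := hz.trans hs.1
        rw [ENNReal.le_div_iff_mul_le (Or.inl (by simpa using hs0)) (Or.inl ENNReal.ofReal_ne_top),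
          ← ENNReal.ofReal_mul (by positivity)]
        refine le_iInf fun w => le_iInf fun hw => le_iInf fun hsw => ENNReal.ofReal_le_ofReal ?_
        by_contra hc
        push Not at hc
        have h1 : Gm m n B w ≤ Gm m n B (s / z * u) :=
          Gm_mono hmn (hc.le.trans (le_of_eq (by ring)))
        have h2 := Gm_scale (m := m) (n := n) (B := B) (l := s / z) (u := u)
            (by rw [one_le_div hz]; exact hs.1.le)
        have h3 : ENNReal.ofReal (s / z) * Gm m n B u < ENNReal.ofReal (s / z) * ENNReal.ofReal z := by
          rw [ENNReal.mul_lt_mul_iff_right (by simp; positivity) ENNReal.ofReal_ne_top]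
          exact h
        rw [← ENNReal.ofReal_mul (by positivity), div_mul_cancel₀ _ hz.ne'] at h3
        exact absurd (hsw.trans (h1.trans h2)) (not_le.2 h3)
    _ ≤ _ := lintegral_mono_set (Set.Ioc_subset_Ioc_left hz.le)

lemma Bm_zero {m n : ℕ} {B : ℝ → ℝ≥0∞} : Bm m n B 0 = 0 := by simp [Bm]

lemma Bm_mono {m n : ℕ} {B : ℝ → ℝ≥0∞} {x y : ℝ} (h : x ≤ y) : Bm m n B x ≤ Bm m n B y :=
  lintegral_mono_set (Set.Ioc_subset_Ioc_right h)

/-- comparability with a power-log function along a filter -/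
def Cmp (l : Filter ℝ) (a b : ℝ) (F : ℝ → ℝ≥0∞) : Prop :=
  ∃ c C : ℝ, 0 < c ∧ 0 < C ∧ ∀ᶠ t in l, ENNReal.ofReal (c * PL a b t) ≤ F t ∧
    F t ≤ ENNReal.ofReal (C * PL a b t)

lemma filt_pos {l : Filter ℝ} (hl : l = 𝓝[>] 0 ∨ l = atTop) : ∀ᶠ t in l, 0 < t := by
  rcases hl with rfl | rfl
  · exact self_mem_nhdsWithin
  · exact eventually_gt_atTop 0

lemma filt_mul {l : Filter ℝ} (hl : l = 𝓝[>] 0 ∨ l = atTop) {C : ℝ} (hC : 0 < C) :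
    Tendsto (fun t => C * t) l l := by
  rcases hl with rfl | rfl
  · refine tendsto_nhdsWithin_iff.2 ⟨?_, ?_⟩
    · have : Tendsto (fun t : ℝ => C * t) (𝓝 0) (𝓝 (C * 0)) := tendsto_id.const_mul C
      rw [mul_zero] at this
      exact this.mono_left nhdsWithin_le_nhds
    · filter_upwards [self_mem_nhdsWithin] with t ht using mul_pos hC ht
  · exact tendsto_id.const_mul_atTop hC

lemma filt_PL {l : Filter ℝ} (hl : l = 𝓝[>] 0 ∨ l = atTop) {a : ℝ} (ha : 0 < a) (b : ℝ) :
    Tendsto (PL a b) l l := by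
  rcases hl with rfl | rfl
  · exact PL_tendsto_zero ha b
  · exact PL_tendsto_atTop ha b

lemma filt_CPL {l : Filter ℝ} (hl : l = 𝓝[>] 0 ∨ l = atTop) {a : ℝ} (ha : 0 < a) (b : ℝ)
    {C : ℝ} (hC : 0 < C) : Tendsto (fun y => C * PL a b y) l l :=
  (filt_mul hl hC).comp (filt_PL hl ha b)

lemma Cmp_inv {l : Filter ℝ} (hl : l = 𝓝[>] 0 ∨ l = atTop) {a b : ℝ} (ha : 0 < a)
    {F : ℝ → ℝ≥0∞} (h : Cmp l a b F) :
    (∃ C : ℝ, 0 < C ∧ ∀ᶠ y in l, ENNReal.ofReal y ≤ F (C * PL (1/a) (-b/a) y)) ∧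
    (∃ c : ℝ, 0 < c ∧ ∀ᶠ y in l, F (c * PL (1/a) (-b/a) y) < ENNReal.ofReal (y/2)) := by
  obtain ⟨c, C, hc, hC, hF⟩ := h
  obtain ⟨C', hC', h1⟩ := inv_upper ha b hc
  obtain ⟨c', hc', h2⟩ := inv_lower ha b (by positivity : 0 < 2 * C)
  have ha' : 0 < 1 / a := by positivity
  refine ⟨⟨C', hC', ?_⟩, ⟨c', hc', ?_⟩⟩
  · filter_upwards [(filt_CPL hl ha' (-b/a) hC').eventually hF, filt_pos hl] with y hy hy0
    exact (ENNReal.ofReal_le_ofReal (h1 y hy0)).trans hy.1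
  · filter_upwards [(filt_CPL hl ha' (-b/a) hc').eventually hF, filt_pos hl] with y hy hy0
    refine hy.2.trans_lt ((ENNReal.ofReal_lt_ofReal_iff (by positivity)).2 ?_)
    have := h2 y hy0
    linarith

lemma Cmp_geninv {l : Filter ℝ} (hl : l = 𝓝[>] 0 ∨ l = atTop) {a b : ℝ} (ha : 0 < a)
    {B : ℝ → ℝ≥0∞} (hB : IsYoung B) (hpos : ∀ x, 0 < x → B x ≠ 0)
    (hfin : ∀ x, 0 ≤ x → B x ≠ ∞) (h : Cmp l a b B) :
    Cmp l (1/a) (-b/a) (fun y => geninv B (ENNReal.ofReal y)) := by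
  obtain ⟨⟨C, hC, h1⟩, ⟨c, hc, h2⟩⟩ := Cmp_inv hl ha h
  refine ⟨c, C, hc, hC, ?_⟩
  filter_upwards [h1, h2, filt_pos hl] with y hy1 hy2 hy0
  have := PL_pos (a := 1/a) (b := -b/a) hy0
  refine ⟨young_le_geninv hB hpos hfin (hy2.le.trans (ENNReal.ofReal_le_ofReal (by linarith))), ?_⟩
  exact geninv_le (by positivity) hy1

lemma Cmp_Bm {l : Filter ℝ} (hl : l = 𝓝[>] 0 ∨ l = atTop) {a b : ℝ} (ha : 0 < a)
    {m n : ℕ} (hmn : m < n) {B : ℝ → ℝ≥0∞} (h : Cmp l a b (Gm m n B)) :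
    Cmp l (1/a) (-b/a) (Bm m n B) := by
  obtain ⟨⟨C, hC, h1⟩, ⟨c, hc, h2⟩⟩ := Cmp_inv hl ha h
  refine ⟨c, C, hc, hC, ?_⟩
  filter_upwards [h1, h2, filt_pos hl] with y hy1 hy2 hy0
  have := PL_pos (a := 1/a) (b := -b/a) hy0
  refine ⟨?_, Bm_upper hy0 (by positivity) hy1⟩
  have h3 := Bm_lower hmn (half_pos hy0) (by positivity) (by linarith : y/2 ≤ y) hy2
  refine le_trans (le_of_eq ?_) h3
  congr 1; field_simp; ring

/-- doubling-type constants -/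
lemma PL_big {a : ℝ} (ha : 0 < a) (b N : ℝ) :
    ∃ c : ℝ, 0 < c ∧ ∀ t, 0 < t → N * PL a b t ≤ PL a b (c * t) := by
  obtain ⟨C, hC0, hC⟩ := ((eventually_gt_atTop 0).and
    ((PL_tendsto_atTop ha (-|b|)).eventually_ge_atTop N)).exists
  refine ⟨C, hC0, fun t ht => le_trans ?_ (PL_mul_ge hC0 ht a b)⟩
  have := PL_pos (a := a) (b := b) ht
  gcongr

/-- from comparability to mutual domination -/
lemma Cmp_dom {l : Filter ℝ} (hl : l = 𝓝[>] 0 ∨ l = atTop) {a b : ℝ} (ha : 0 < a)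
    {F : ℝ → ℝ≥0∞} (h : Cmp l a b F) :
    (∃ c : ℝ, 0 < c ∧ ∀ᶠ t in l, F t ≤ ENNReal.ofReal (PL a b (c * t))) ∧
    (∃ c : ℝ, 0 < c ∧ ∀ᶠ t in l, ENNReal.ofReal (PL a b t) ≤ F (c * t)) := by
  obtain ⟨c, C, hc, hC, hF⟩ := h
  obtain ⟨k, hk, h1⟩ := PL_big ha b C
  obtain ⟨k', hk', h2⟩ := PL_big ha b c⁻¹
  refine ⟨⟨k, hk, ?_⟩, ⟨k', hk', ?_⟩⟩
  · filter_upwards [hF, filt_pos hl] with t ht ht0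
    exact ht.2.trans (ENNReal.ofReal_le_ofReal (h1 t ht0))
  · filter_upwards [(filt_mul hl hk').eventually hF, filt_pos hl] with t ht ht0
    refine le_trans (ENNReal.ofReal_le_ofReal ?_) ht.1
    have := h2 t ht0
    rwa [inv_mul_le_iff₀ hc] at this

lemma dom_Cmp {l : Filter ℝ} (hl : l = 𝓝[>] 0 ∨ l = atTop) {a b : ℝ}
    {F : ℝ → ℝ≥0∞} 
    (h1 : ∃ c : ℝ, 0 < c ∧ ∀ᶠ t in l, F t ≤ ENNReal.ofReal (PL a b (c * t)))
    (h2 : ∃ c : ℝ, 0 < c ∧ ∀ᶠ t in l, ENNReal.ofReal (PL a b t) ≤ F (c * t)) :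
    Cmp l a b F := by
  obtain ⟨c, hc, h1⟩ := h1
  obtain ⟨k, hk, h2⟩ := h2
  refine ⟨PL a (-|b|) k⁻¹, PL a |b| c, PL_pos (inv_pos.2 hk), PL_pos hc, ?_⟩
  filter_upwards [h1, (filt_mul hl (inv_pos.2 hk)).eventually h2, filt_pos hl] with t ht1 ht2 ht0
  rw [mul_inv_cancel_left₀ hk.ne'] at ht2
  exact ⟨(ENNReal.ofReal_le_ofReal (PL_mul_ge (inv_pos.2 hk) ht0 a b)).trans ht2,
    ht1.trans (ENNReal.ofReal_le_ofReal (PL_mul_le hc ht0 a b))⟩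

lemma modelZero_eq (p a : ℝ) : ∀ᶠ t in 𝓝[>] (0:ℝ), modelZero p a t = ENNReal.ofReal (PL p a t) := by
  have h0 : ∀ᶠ t : ℝ in 𝓝[>] 0, t ∈ Ioo (0:ℝ) 1 := Ioo_mem_nhdsGT one_pos
  filter_upwards [h0] with t ht
  unfold modelZero PL LL
  rw [abs_of_nonpos (Real.log_nonpos ht.1.le ht.2.le)]; rfl

lemma modelInf_eq (p a : ℝ) : ∀ᶠ t in atTop, modelInf p a t = ENNReal.ofReal (PL p a t) := by
  filter_upwards [eventually_ge_atTop (1:ℝ)] with t ht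
  unfold modelInf PL LL
  rw [abs_of_nonneg (Real.log_nonneg ht)]

lemma ev_zero {p : ℝ → Prop} (h : ∀ᶠ t in 𝓝[>] (0:ℝ), p t) :
    ∃ t0 : ℝ, 0 < t0 ∧ ∀ t, 0 < t → t ≤ t0 → p t := by
  obtain ⟨u, hu, h⟩ := (mem_nhdsGT_iff_exists_Ioc_subset).1 h
  exact ⟨u, hu, fun t h1 h2 => h ⟨h1, h2⟩⟩

lemma zero_ev {p : ℝ → Prop} {t0 : ℝ} (h0 : 0 < t0) (h : ∀ t, 0 ≤ t → t ≤ t0 → p t) :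
    ∀ᶠ t in 𝓝[>] (0:ℝ), p t := by
  filter_upwards [Ioc_mem_nhdsGT h0] with t ht using h t ht.1.le ht.2

lemma equivZero_to_Cmp {B : ℝ → ℝ≥0∞} {p a : ℝ} (h : EquivNearZero B (modelZero p a)) :
    Cmp (𝓝[>] 0) p a B := by
  obtain ⟨⟨c, t0, hc, ht0, h1⟩, ⟨k, t1, hk, ht1, h2⟩⟩ := h
  refine dom_Cmp (Or.inl rfl) ⟨k, hk, ?_⟩ ⟨c, hc, ?_⟩
  · filter_upwards [zero_ev ht1 h2, (filt_mul (Or.inl rfl) hk).eventually (modelZero_eq p a)]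
      with t h3 h4
    rwa [h4] at h3
  · filter_upwards [zero_ev ht0 h1, modelZero_eq p a] with t h3 h4
    rwa [h4] at h3

lemma equivInf_to_Cmp {B : ℝ → ℝ≥0∞} {p a : ℝ} (h : EquivNearInfty B (modelInf p a)) :
    Cmp atTop p a B := by
  obtain ⟨⟨c, t0, hc, ht0, h1⟩, ⟨k, t1, hk, ht1, h2⟩⟩ := h
  refine dom_Cmp (Or.inr rfl) ⟨k, hk, ?_⟩ ⟨c, hc, ?_⟩
  · filter_upwards [(eventually_ge_atTop t1).mono h2,
      (filt_mul (Or.inr rfl) hk).eventually (modelInf_eq p a)] with t h3 h4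
    rwa [h4] at h3
  · filter_upwards [(eventually_ge_atTop t0).mono h1, modelInf_eq p a] with t h3 h4
    rwa [h4] at h3

lemma Cmp_to_equivZero {F : ℝ → ℝ≥0∞} {p a : ℝ} (hp : 0 < p) (hF : F 0 = 0)
    (h : Cmp (𝓝[>] 0) p a F) : EquivNearZero F (modelZero p a) := by
  obtain ⟨⟨c, hc, h1⟩, ⟨k, hk, h2⟩⟩ := Cmp_dom (Or.inl rfl) hp h
  have hm : modelZero p a 0 = 0 := by simp [modelZero, Real.zero_rpow hp.ne']
  constructor
  · obtain ⟨t0, ht0, h3⟩ := ev_zero (h2.and (modelZero_eq p a))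
    refine ⟨k, t0, hk, ht0, fun t ht htt => ?_⟩
    rcases ht.eq_or_lt with rfl | ht
    · simp [hm]
    · obtain ⟨h4, h5⟩ := h3 t ht htt
      rwa [h5]
  · obtain ⟨t0, ht0, h3⟩ := ev_zero (h1.and
      ((filt_mul (Or.inl rfl) hc).eventually (modelZero_eq p a)))
    refine ⟨c, t0, hc, ht0, fun t ht htt => ?_⟩
    rcases ht.eq_or_lt with rfl | ht
    · simp [hF]
    · obtain ⟨h4, h5⟩ := h3 t ht htt
      rwa [h5]

lemma Cmp_to_equivInf {F H : ℝ → ℝ≥0∞} {p a : ℝ} (hp : 0 < p)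
    (hH : ∀ᶠ t in atTop, H t = ENNReal.ofReal (PL p a t))
    (h : Cmp atTop p a F) : EquivNearInfty F H := by
  obtain ⟨⟨c, hc, h1⟩, ⟨k, hk, h2⟩⟩ := Cmp_dom (Or.inr rfl) hp h
  constructor
  · obtain ⟨t0, h3⟩ := eventually_atTop.1 (h2.and hH)
    refine ⟨k, max t0 1, hk, by positivity, fun t ht => ?_⟩
    obtain ⟨h4, h5⟩ := h3 t (le_of_max_le_left ht)
    rwa [h5]
  · obtain ⟨t0, h3⟩ := eventually_atTop.1 (h1.and
      ((filt_mul (Or.inr rfl) hc).eventually hH))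
    refine ⟨c, max t0 1, hc, by positivity, fun t ht => ?_⟩
    obtain ⟨h4, h5⟩ := h3 t (le_of_max_le_left ht)
    rwa [h5]


lemma pos_of_Cmp {B : ℝ → ℝ≥0∞} (hB : IsYoung B) {p a : ℝ} (h : Cmp (𝓝[>] 0) p a B) :
    ∀ x, 0 < x → B x ≠ 0 := by
  intro x hx
  obtain ⟨c, C, hc, hC, h⟩ := h
  obtain ⟨t0, ht0, h⟩ := ev_zero h
  have ht : 0 < min x t0 := lt_min hx ht0
  have h1 := (h _ ht (min_le_right _ _)).1.trans (young_mono hB ht.le (min_le_left _ _))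
  have h2 : 0 < ENNReal.ofReal (c * PL p a (min x t0)) := by
    have := PL_pos (a := p) (b := a) ht
    simp; positivity
  exact (h2.trans_le h1).ne'

lemma fin_of_Cmp {B : ℝ → ℝ≥0∞} (hB : IsYoung B) {p a : ℝ} (h : Cmp atTop p a B) :
    ∀ x, 0 ≤ x → B x ≠ ∞ := by
  intro x hx
  obtain ⟨c, C, hc, hC, h⟩ := h
  obtain ⟨t0, h⟩ := eventually_atTop.1 h
  have h1 := (young_mono hB hx (le_max_left x t0)).trans (h _ (le_max_right _ _)).2
  exact (h1.trans_lt ENNReal.ofReal_lt_top).ne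

lemma Cmp_double {l : Filter ℝ} (hl : l = 𝓝[>] 0 ∨ l = atTop) {a b : ℝ}
    {F : ℝ → ℝ≥0∞} (h : Cmp l a b F) :
    ∃ K : ℝ, 0 < K ∧ ∀ᶠ t in l, F (2 * t) ≤ ENNReal.ofReal K * F t := by
  obtain ⟨c, C, hc, hC, h⟩ := h
  have h2 := PL_pos (a := a) (b := |b|) two_pos
  refine ⟨C * PL a |b| 2 / c, by positivity, ?_⟩
  filter_upwards [h, (filt_mul hl two_pos).eventually h, filt_pos hl] with t h3 h4 h5
  calc F (2 * t) ≤ ENNReal.ofReal (C * PL a b (2 * t)) := h4.2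
    _ ≤ ENNReal.ofReal (C * (PL a |b| 2 * PL a b t)) := by
        gcongr; exact PL_mul_le two_pos h5 a b
    _ = ENNReal.ofReal (C * PL a |b| 2 / c) * ENNReal.ofReal (c * PL a b t) := by
        rw [← ENNReal.ofReal_mul (by positivity)]; congr 1; field_simp
    _ ≤ _ := by gcongr; exact h3.1

lemma young_double {B : ℝ → ℝ≥0∞} (hB : IsYoung B) {p0 a0 pi ai : ℝ}
    (h0 : Cmp (𝓝[>] 0) p0 a0 B) (hi : Cmp atTop pi ai B) :
    ∃ K : ℝ, 1 ≤ K ∧ ∀ x, 0 ≤ x → B (2 * x) ≤ ENNReal.ofReal K * B x := by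
  obtain ⟨K0, hK0, h1⟩ := Cmp_double (Or.inl rfl) h0
  obtain ⟨K1, hK1, h2⟩ := Cmp_double (Or.inr rfl) hi
  obtain ⟨t0, ht0, h1⟩ := ev_zero h1
  obtain ⟨t1, h2⟩ := eventually_atTop.1 h2
  have hpos := pos_of_Cmp hB h0
  have hfin := fin_of_Cmp hB hi
  set t2 := max t1 t0 with ht2
  have ht20 : 0 < t2 := lt_max_of_lt_right ht0
  set K2 : ℝ := (B (2 * t2) / B t0).toReal with hK2
  have hK2' : B (2 * t2) = ENNReal.ofReal K2 * B t0 := by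
    rw [hK2, ENNReal.ofReal_toReal (ENNReal.div_ne_top (hfin _ (by positivity)) (hpos _ ht0)),
      ENNReal.div_mul_cancel (hpos _ ht0) (hfin _ ht0.le)]
  refine ⟨max (max K0 K1) (max K2 1), le_max_of_le_right (le_max_right _ _), fun x hx => ?_⟩
  rcases hx.eq_or_lt with rfl | hx
  · simp [hB.map_zero]
  rcases le_total x t0 with h | h
  · exact (h1 x hx h).trans (by gcongr; exact le_max_of_le_left (le_max_left _ _))
  rcases le_total t1 x with h' | h'
  · exact (h2 x h').trans (by gcongr; exact le_max_of_le_left (le_max_right _ _))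
  calc B (2 * x) ≤ B (2 * t2) := young_mono hB (by positivity)
        (by have := h'.trans (le_max_left t1 t0); linarith)
    _ = ENNReal.ofReal K2 * B t0 := hK2'
    _ ≤ _ := by
      gcongr
      · exact le_max_of_le_right (le_max_left _ _)
      · exact young_mono hB ht0.le h

lemma eext_mono {B : ℝ → ℝ≥0∞} (hB : ∀ x y, 0 ≤ x → x ≤ y → B x ≤ B y) {x y : ℝ≥0∞}
    (h : x ≤ y) : eext B x ≤ eext B y := by
  unfold eext
  split_ifs with h1 h2 h2
  · exact le_rfl
  · exact absurd (top_le_iff.1 (h1 ▸ h)) h2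
  · exact le_top
  · exact hB _ _ ENNReal.toReal_nonneg (ENNReal.toReal_mono h2 h)

lemma eext_ofReal {B : ℝ → ℝ≥0∞} {x : ℝ} (hx : 0 ≤ x) : eext B (ENNReal.ofReal x) = B x := by
  simp [eext, ENNReal.toReal_ofReal hx]

lemma eext_scale {B : ℝ → ℝ≥0∞} (hB : IsYoung B) {l : ℝ} (hl : 0 < l) (hl1 : l ≤ 1) (x : ℝ≥0∞) :
    eext B (ENNReal.ofReal l * x) ≤ ENNReal.ofReal l * eext B x := by
  have hl' : ENNReal.ofReal l ≠ 0 := by simpa using hl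
  induction x with
  | top => simp [eext, ENNReal.mul_top hl']
  | coe x =>
    have e : (x : ℝ≥0∞) = ENNReal.ofReal x := by simp
    rw [e, ← ENNReal.ofReal_mul hl.le, eext_ofReal (by positivity), eext_ofReal (by positivity)]
    exact young_scale hB hl.le hl1 x.2

lemma eext_double {B : ℝ → ℝ≥0∞} {K : ℝ} (hK : 1 ≤ K)
    (h : ∀ x, 0 ≤ x → B (2 * x) ≤ ENNReal.ofReal K * B x) (i : ℕ) (x : ℝ≥0∞) :
    eext B (2 ^ i * x) ≤ ENNReal.ofReal K ^ i * eext B x := by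
  have hK0 : ENNReal.ofReal K ≠ 0 := by simp; linarith
  have h1 : ∀ x : ℝ≥0∞, eext B (2 * x) ≤ ENNReal.ofReal K * eext B x := by
    intro x
    induction x with
    | top => simp [eext, ENNReal.mul_top hK0]
    | coe x =>
      have e : (x : ℝ≥0∞) = ENNReal.ofReal x := by simp
      have e2 : (2 : ℝ≥0∞) = ENNReal.ofReal 2 := by simp
      rw [e, e2, ← ENNReal.ofReal_mul two_pos.le, eext_ofReal (by positivity),
        eext_ofReal (by positivity)]
      exact h x x.2
  induction i with
  | zero => simp
  | succ i ih =>
    calc eext B (2 ^ (i + 1) * x) = eext B (2 * (2 ^ i * x)) := by ring_nf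
      _ ≤ ENNReal.ofReal K * (ENNReal.ofReal K ^ i * eext B x) := (h1 _).trans (by gcongr)
      _ = _ := by ring

lemma young_unbounded {B : ℝ → ℝ≥0∞} (hB : IsYoung B) (hpos : ∀ x, 0 < x → B x ≠ 0)
    {X : ℝ≥0∞} (hX : X ≠ ∞) : ∃ w : ℝ, 1 ≤ w ∧ X ≤ B w := by
  have h1 := hpos 1 one_pos
  by_contra hc
  push Not at hc
  have h2 : ∀ w : ℝ, 1 ≤ w → ENNReal.ofReal w * B 1 ≤ X := by
    intro w hw
    have h3 := young_scale hB (l := 1 / w) (y := w) (by positivity)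
      (by rw [div_le_one (by linarith)]; exact hw) (by linarith)
    have e : 1 / w * w = 1 := by field_simp
    rw [e] at h3
    calc ENNReal.ofReal w * B 1 ≤ ENNReal.ofReal w * (ENNReal.ofReal (1/w) * B w) := by gcongr
      _ = B w := by
        rw [← mul_assoc, ← ENNReal.ofReal_mul (by linarith)]
        have : w * (1/w) = 1 := by field_simp
        rw [this]; simp
      _ ≤ X := (hc w hw).le
  have h3 : B 1 ≠ ∞ := (hc 1 le_rfl).ne_top
  set r := (X / B 1).toReal with hr
  have hr' : ENNReal.ofReal r = X / B 1 := ENNReal.ofReal_toReal (ENNReal.div_ne_top hX h1)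
  have h4 := h2 (r + 1) (by have : 0 ≤ r := ENNReal.toReal_nonneg
                            linarith)
  rw [ENNReal.ofReal_add ENNReal.toReal_nonneg zero_le_one, add_mul, hr',
    ENNReal.div_mul_cancel h1 h3] at h4
  simp only [ENNReal.ofReal_one, one_mul] at h4
  exact absurd h4 (not_le.2 (ENNReal.lt_add_right hX h1))

lemma young_geninv_ne_top {B : ℝ → ℝ≥0∞} (hB : IsYoung B) (hpos : ∀ x, 0 < x → B x ≠ 0)
    {u : ℝ} : geninv B (ENNReal.ofReal u) ≠ ∞ := by
  obtain ⟨w, hw, h⟩ := young_unbounded hB hpos (X := ENNReal.ofReal u) ENNReal.ofReal_ne_top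
  exact ((geninv_le (by linarith) h).trans_lt ENNReal.ofReal_lt_top).ne

lemma young_geninv_ne_zero {B : ℝ → ℝ≥0∞} (hB : IsYoung B) (hpos : ∀ x, 0 < x → B x ≠ 0)
    (hfin : ∀ x, 0 ≤ x → B x ≠ ∞)
    {u : ℝ} (hu : 0 < u) : geninv B (ENNReal.ofReal u) ≠ 0 := by
  set b := (B 1).toReal with hb
  have hb0 : 0 < b := ENNReal.toReal_pos (hpos 1 one_pos) (hfin 1 zero_le_one)
  have hb' : B 1 = ENNReal.ofReal b := (ENNReal.ofReal_toReal (hfin 1 zero_le_one)).symm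
  set l := min 1 (u / b)
  have hl0 : 0 < l := lt_min one_pos (by positivity)
  have h1 := young_scale hB hl0.le (min_le_left _ _) zero_le_one
  rw [hb', ← ENNReal.ofReal_mul hl0.le] at h1
  have h2 : B (l * 1) ≤ ENNReal.ofReal u := h1.trans (by
    gcongr
    have : l ≤ u / b := min_le_right _ _
    rwa [le_div_iff₀ hb0] at this)
  have h3 := young_le_geninv hB hpos hfin h2
  have h4 : 0 < ENNReal.ofReal (l * 1) := by simpa using hl0
  exact (h4.trans_le h3).ne'

lemma piece {m n : ℕ} (hm : 1 ≤ m) (hmn : m < n) {B : ℝ → ℝ≥0∞} (hB : IsYoung B)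
    (hpos : ∀ x, 0 < x → B x ≠ 0) (hfin : ∀ x, 0 ≤ x → B x ≠ ∞)
    {I : Set ℝ} {L : ℝ} (hL : 0 < L) (hI : volume I = ENNReal.ofReal L)
    (g : ℝ → ℝ≥0∞) {u : ℝ} (hu : 0 < u) (hLu : L * u ≤ 2)
    (he : ∫⁻ t in I, eext (Bm m n B) (g t) ≤ ENNReal.ofReal (L * u)) :
    eext B (ENNReal.ofReal (L ^ ((m:ℝ)/n - 1) / 16) * ∫⁻ t in I, g t) ≤ ENNReal.ofReal u := by
  set β := (geninv B (ENNReal.ofReal u)).toReal with hβ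
  have hβ' : geninv B (ENNReal.ofReal u) = ENNReal.ofReal β :=
    (ENNReal.ofReal_toReal (young_geninv_ne_top hB hpos)).symm
  have hβ0 : 0 < β := ENNReal.toReal_pos (young_geninv_ne_zero hB hpos hfin hu)
    (young_geninv_ne_top hB hpos)
  set θ : ℝ := (m:ℝ)/n with hθ
  have hθ0 : 0 ≤ θ := by positivity
  have hn0 : (0:ℝ) < n := by
    have : 0 < n := by omega
    positivity
  have hθ1 : θ ≤ 1 := by
    rw [hθ, div_le_one hn0]
    exact_mod_cast hmn.le
  have hG : Gm m n B u ≤ ENNReal.ofReal (u ^ θ * β) := by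
    refine (Gm_le hu le_rfl).trans (le_of_eq ?_)
    rw [hβ', ← ENNReal.ofReal_mul hβ0.le, ← ENNReal.ofReal_mul hu.le, exp_eq hmn]
    congr 1
    have : u ^ θ = u * u ^ (θ - 1) := by
      nth_rewrite 2 [← Real.rpow_one u]
      rw [← Real.rpow_add hu]; ring_nf
    rw [this]; ring
  have huθ := Real.rpow_pos_of_pos hu θ
  set z : ℝ := 2 * (u ^ θ * β) with hz
  have hz0 : 0 < z := by positivity
  have hGz : Gm m n B u < ENNReal.ofReal z :=
    hG.trans_lt ((ENNReal.ofReal_lt_ofReal_iff hz0).2 (by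
      have : 0 < u ^ θ * β := by positivity
      linarith))
  have hpt : ∀ x : ℝ≥0∞, x ≤ ENNReal.ofReal z + ENNReal.ofReal (z/u) * eext (Bm m n B) x := by
    intro x
    have hzu : ENNReal.ofReal (z/u) ≠ 0 := by simp; positivity
    induction x with
    | top => simp [eext, ENNReal.mul_top hzu]
    | coe x =>
      have e : (x : ℝ≥0∞) = ENNReal.ofReal x := by simp
      rw [e, eext_ofReal (NNReal.coe_nonneg x)]
      rcases le_total (x:ℝ) z with h | h
      · exact (ENNReal.ofReal_le_ofReal h).trans le_self_add
      · have h1 := Bm_lower hmn hz0 hu.le h hGz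
        calc ENNReal.ofReal x = ENNReal.ofReal z +
              ENNReal.ofReal (z/u) * ENNReal.ofReal ((x - z) * (u / z)) := by
              rw [← ENNReal.ofReal_mul (by positivity), ← ENNReal.ofReal_add hz0.le]
              · congr 1; field_simp; ring
              · have : 0 ≤ (x:ℝ) - z := by linarith
                positivity
          _ ≤ _ := by gcongr
  have hD : ∫⁻ t in I, g t ≤ ENNReal.ofReal (2 * z * L) := by
    calc ∫⁻ t in I, g t ≤ ∫⁻ t in I, (ENNReal.ofReal z +
            ENNReal.ofReal (z/u) * eext (Bm m n B) (g t)) := lintegral_mono fun t => hpt _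
      _ = ENNReal.ofReal z * ENNReal.ofReal L +
            ENNReal.ofReal (z/u) * ∫⁻ t in I, eext (Bm m n B) (g t) := by
          rw [lintegral_add_left measurable_const, lintegral_const_mul' _ _ ENNReal.ofReal_ne_top,
            setLIntegral_const, hI]
      _ ≤ ENNReal.ofReal z * ENNReal.ofReal L + ENNReal.ofReal (z/u) * ENNReal.ofReal (L * u) := by
          gcongr
      _ = _ := by
          rw [← ENNReal.ofReal_mul (by positivity), ← ENNReal.ofReal_mul (by positivity),
            ← ENNReal.ofReal_add (by positivity) (by positivity)]
          congr 1; field_simp; ring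
  have hfin2 : ENNReal.ofReal (L ^ (θ - 1) / 16) * ∫⁻ t in I, g t ≤ ENNReal.ofReal (β / 2) := by
    calc _ ≤ ENNReal.ofReal (L ^ (θ - 1) / 16) * ENNReal.ofReal (2 * z * L) := by gcongr
      _ = ENNReal.ofReal (((L * u) ^ θ) * β / 4) := by
          rw [← ENNReal.ofReal_mul (by positivity)]
          congr 1
          have : L ^ θ = L ^ (θ - 1) * L := by
            nth_rewrite 3 [← Real.rpow_one L]
            rw [← Real.rpow_add hL]; ring_nf
          rw [Real.mul_rpow hL.le hu.le, this, hz]; ring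
      _ ≤ _ := by
          refine ENNReal.ofReal_le_ofReal ?_
          have : (L * u) ^ θ ≤ 2 := by
            calc (L * u) ^ θ ≤ 2 ^ θ := Real.rpow_le_rpow (by positivity) hLu hθ0
              _ ≤ 2 ^ (1:ℝ) := Real.rpow_le_rpow_of_exponent_le one_le_two hθ1
              _ = 2 := Real.rpow_one 2
          nlinarith
  refine (eext_mono (fun x y => young_mono hB) hfin2).trans ?_
  rw [eext_ofReal (by positivity)]
  refine (lt_of_lt_geninv (by positivity) ?_).le
  rw [hβ']
  exact (ENNReal.ofReal_lt_ofReal_iff hβ0).2 (by linarith)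

lemma piece' {m n : ℕ} (hm : 1 ≤ m) (hmn : m < n) {B : ℝ → ℝ≥0∞} (hB : IsYoung B)
    (hpos : ∀ x, 0 < x → B x ≠ 0) (hfin : ∀ x, 0 ≤ x → B x ≠ ∞)
    {I : Set ℝ} {L : ℝ} (hL : 0 < L) (hI : volume I = ENNReal.ofReal L)
    (g : ℝ → ℝ≥0∞) (he : ∫⁻ t in I, eext (Bm m n B) (g t) ≤ 1) :
    eext B (ENNReal.ofReal (L ^ ((m:ℝ)/n - 1) / 16) * ∫⁻ t in I, g t) ≤
      (∫⁻ t in I, eext (Bm m n B) (g t)) / ENNReal.ofReal L := by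
  set e := ∫⁻ t in I, eext (Bm m n B) (g t) with hee
  have het : e ≠ ∞ := (he.trans_lt ENNReal.one_lt_top).ne
  set r := e.toReal with hr
  have hr0 : 0 ≤ r := ENNReal.toReal_nonneg
  have hr1 : r ≤ 1 := by
    have := ENNReal.toReal_mono ENNReal.one_ne_top he
    simpa using this
  have her : e = ENNReal.ofReal r := (ENNReal.ofReal_toReal het).symm
  refine ENNReal.le_of_forall_pos_le_add fun ε hε _ => ?_
  set d : ℝ := min (ε:ℝ) (1/L) with hd
  have hd0 : 0 < d := lt_min hε (by positivity)
  have hd1 : L * d ≤ 1 := by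
    have : d ≤ 1 / L := min_le_right _ _
    rw [le_div_iff₀ hL] at this; linarith
  have eq1 : L * (r / L + d) = r + L * d := by field_simp
  have h := piece hm hmn hB hpos hfin hL hI g (u := r / L + d) (by positivity)
    (by rw [eq1]; linarith) (by
      rw [← hee, her, eq1]; gcongr
      have : 0 < L * d := by positivity
      linarith)
  refine h.trans ?_
  rw [her, ENNReal.ofReal_add (by positivity) hd0.le, ENNReal.ofReal_div_of_pos hL]
  gcongr
  calc ENNReal.ofReal d ≤ ENNReal.ofReal ε := by gcongr; exact min_le_left _ _
    _ = ε := by simp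

lemma eext_tsum {B : ℝ → ℝ≥0∞} (hB : IsYoung B) (hpos : ∀ x, 0 < x → B x ≠ 0)
    (hfin : ∀ x, 0 ≤ x → B x ≠ ∞) (Y : ℕ → ℝ≥0∞) :
    eext B (∑' i, Y i) ≤ ∑' i, eext B (2 ^ (i + 2) * Y i) := by
  have hmono : ∀ x y : ℝ≥0∞, x ≤ y → eext B x ≤ eext B y :=
    fun x y h => eext_mono (fun x y => young_mono hB) h
  have key : ∀ R : ℝ, 0 < R → ENNReal.ofReal R ≤ ∑' i, Y i →
      B R ≤ ∑' i, eext B (2 ^ (i + 2) * Y i) := by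
    intro R hR h
    have : ∃ i, ENNReal.ofReal R ≤ 2 ^ (i + 2) * Y i := by
      by_contra hc
      push Not at hc
      have h1 : ∑' i, Y i ≤ ∑' i, (ENNReal.ofReal R * 2⁻¹ ^ 2) * 2⁻¹ ^ i := by
        refine ENNReal.tsum_le_tsum fun i => ?_
        have h2 : (2:ℝ≥0∞) ^ (i + 2) * (2⁻¹) ^ (i + 2) = 1 := by
          rw [← mul_pow, ENNReal.mul_inv_cancel (by simp) (by simp), one_pow]
        calc Y i = (2 ^ (i + 2) * Y i) * 2⁻¹ ^ (i + 2) := by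
              rw [mul_right_comm, h2, one_mul]
          _ ≤ ENNReal.ofReal R * 2⁻¹ ^ (i + 2) := by gcongr; exact (hc i).le
          _ = _ := by ring
      rw [ENNReal.tsum_mul_left, ENNReal.tsum_geometric, ENNReal.one_sub_inv_two, inv_inv] at h1
      have h3 : ENNReal.ofReal R * 2⁻¹ ^ 2 * 2 = ENNReal.ofReal (R / 2) := by
        rw [ENNReal.ofReal_div_of_pos two_pos]
        simp only [ENNReal.ofReal_ofNat, div_eq_mul_inv]
        rw [pow_two, mul_assoc, mul_assoc, ENNReal.inv_mul_cancel (by simp) (by simp), mul_one]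
      rw [h3] at h1
      have h4 := h.trans h1
      rw [ENNReal.ofReal_le_ofReal_iff (by positivity)] at h4
      linarith
    obtain ⟨i, hi⟩ := this
    have h5 := hmono _ _ hi
    rw [eext_ofReal hR.le] at h5
    exact h5.trans (ENNReal.le_tsum i)
  by_cases hS : ∑' i, Y i = ∞
  · have hX : ∑' i, eext B (2 ^ (i + 2) * Y i) = ∞ := by
      by_contra hX
      obtain ⟨w, hw, h⟩ := young_unbounded hB hpos hX
      have h1 := young_strict hB hpos hfin (by linarith : 0 ≤ w) (by linarith : w < w + 1)
      have h2 := key (w + 1) (by linarith) (by rw [hS]; exact le_top)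
      exact absurd (h2.trans h) (not_le.2 h1)
    rw [hX]; exact le_top
  · by_cases h0 : ∑' i, Y i = 0
    · rw [h0]; simp [eext, hB.map_zero]
    · have h := key (∑' i, Y i).toReal (ENNReal.toReal_pos h0 hS)
        (by rw [ENNReal.ofReal_toReal hS])
      simpa [eext, hS] using h


lemma dyadic_union {M : ℝ} (hM : 1 < M) : (⋃ k : ℤ, Ico (M ^ k) (M ^ (k + 1))) = Ioi (0:ℝ) := by
  ext x
  simp only [mem_iUnion, mem_Ioi]
  constructor
  · rintro ⟨k, hk⟩
    exact (zpow_pos (by linarith) k).trans_le hk.1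
  · intro hx
    exact exists_mem_Ico_zpow hx hM

lemma dyadic_disj {M : ℝ} (hM : 1 < M) :
    Pairwise (Function.onFun Disjoint fun k : ℤ => Ico (M ^ k) (M ^ (k + 1))) := by
  have key : ∀ i j : ℤ, i < j → Disjoint (Ico (M ^ i) (M ^ (i + 1))) (Ico (M ^ j) (M ^ (j + 1))) := by
    intro i j hij
    rw [Set.disjoint_left]
    intro x hx hy
    have : M ^ (i + 1) ≤ M ^ j := zpow_le_zpow_right₀ hM.le (by omega)
    linarith [hx.2, hy.1]
  intro i j hij
  rcases lt_or_gt_of_ne hij with h | h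
  · exact key i j h
  · exact (key j i h).symm

lemma hardy_dyadic {m n : ℕ} (hmn : m < n) {M : ℝ} (hM : 1 < M) (g : ℝ → ℝ≥0∞)
    (k : ℤ) {t : ℝ} (ht : M ^ k ≤ t) :
    hardyOp m n g t ≤ ∑' i : ℕ, ENNReal.ofReal ((M ^ (k + i)) ^ ((m:ℝ)/n - 1)) *
      ∫⁻ s in Ico (M ^ (k + i)) (M ^ (k + i + 1)), g s := by
  have hM0 : 0 < M := by linarith
  have hn0 : (0:ℝ) < n := by
    have : 0 < n := by omega
    positivity
  have hθ1 : (m:ℝ)/n - 1 ≤ 0 := by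
    have : (m:ℝ)/n ≤ 1 := by
      rw [div_le_one hn0]
      exact_mod_cast hmn.le
    linarith
  have hsub : Ioi t ⊆ ⋃ i : ℕ, Ico (M ^ (k + i)) (M ^ (k + i + 1)) := by
    intro x hx
    have hx' : t < x := hx
    have hx0 : 0 < x := (zpow_pos hM0 k).trans_le (ht.trans hx'.le)
    obtain ⟨j, hj⟩ := exists_mem_Ico_zpow hx0 hM
    have hkj : k ≤ j := by
      by_contra hc
      have : M ^ (j + 1) ≤ M ^ k := zpow_le_zpow_right₀ hM.le (by omega)
      linarith [hj.2]
    obtain ⟨i, hi⟩ := Int.le.dest hkj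
    rw [mem_iUnion]
    exact ⟨i, by rw [hi]; exact hj⟩
  unfold hardyOp
  refine (lintegral_mono_set hsub).trans ((lintegral_iUnion_le _ _).trans ?_)
  refine ENNReal.tsum_le_tsum fun i => ?_
  rw [← lintegral_const_mul' _ _ ENNReal.ofReal_ne_top]
  refine setLIntegral_mono' measurableSet_Ico fun s hs => ?_
  rw [mul_comm]
  exact mul_le_mul' (ENNReal.ofReal_le_ofReal
    (Real.rpow_le_rpow_of_nonpos (zpow_pos hM0 _) hs.1 hθ1)) le_rfl

lemma hardy_modular {m n : ℕ} (hm : 1 ≤ m) (hmn : m < n) {B : ℝ → ℝ≥0∞} (hB : IsYoung B)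
    (hpos : ∀ x, 0 < x → B x ≠ 0) (hfin : ∀ x, 0 ≤ x → B x ≠ ∞)
    {K : ℝ} (hK : 1 ≤ K) (hK2 : ∀ x, 0 ≤ x → B (2 * x) ≤ ENNReal.ofReal K * B x) :
    ∃ c : ℝ, 0 < c ∧ ∀ g : ℝ → ℝ≥0∞,
      ∫⁻ t in Ioi (0:ℝ), eext (Bm m n B) (g t) ≤ 1 →
      ∫⁻ t in Ioi (0:ℝ), eext B (ENNReal.ofReal c * hardyOp m n g t) ≤ 1 := by
  set M : ℝ := 2 * K with hMdef
  have hM : 1 < M := by linarith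
  have hM0 : 0 < M := by linarith
  have hM1 : 0 < M - 1 := by linarith
  set θ : ℝ := (m:ℝ)/n with hθ
  set c' : ℝ := (M - 1) ^ (θ - 1) / 16 with hc'
  have hc'0 : 0 < c' := by positivity
  set N : ℝ := 2 * K ^ 2 with hN
  have hN1 : 1 ≤ N := by nlinarith
  refine ⟨N⁻¹ * c', by positivity, fun g hg => ?_⟩
  set I : ℤ → Set ℝ := fun k => Ico (M ^ k) (M ^ (k + 1)) with hI
  set e : ℤ → ℝ≥0∞ := fun k => ∫⁻ t in I k, eext (Bm m n B) (g t) with he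
  have hesum : ∑' k, e k ≤ 1 := by
    rw [he, ← lintegral_iUnion (fun k => measurableSet_Ico) (dyadic_disj hM), dyadic_union hM]
    exact hg
  have he1 : ∀ k, e k ≤ 1 := fun k => (ENNReal.le_tsum k).trans hesum
  have hLpos : ∀ k : ℤ, 0 < M ^ k * (M - 1) := fun k => mul_pos (zpow_pos hM0 k) hM1
  have hvol : ∀ k : ℤ, volume (I k) = ENNReal.ofReal (M ^ k * (M - 1)) := by
    intro k
    rw [hI, Real.volume_Ico]
    congr 1
    rw [zpow_add_one₀ hM0.ne']; ring
  have hp : ∀ k : ℤ, eext B (ENNReal.ofReal ((M ^ k * (M - 1)) ^ (θ - 1) / 16) *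
      ∫⁻ t in I k, g t) ≤ e k / ENNReal.ofReal (M ^ k * (M - 1)) := fun k =>
    piece' hm hmn hB hpos hfin (hLpos k) (hvol k) g (he1 k)
  have hpt : ∀ k : ℤ, ∀ t ∈ I k, eext B (ENNReal.ofReal c' * hardyOp m n g t) ≤
      ∑' i : ℕ, ENNReal.ofReal K ^ (i + 2) *
        (e (k + i) / ENNReal.ofReal (M ^ (k + i) * (M - 1))) := by
    intro k t ht
    have h1 : ENNReal.ofReal c' * hardyOp m n g t ≤ ∑' i : ℕ,
        ENNReal.ofReal ((M ^ (k + i) * (M - 1)) ^ (θ - 1) / 16) * ∫⁻ t in I (k + i), g t := by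
      calc _ ≤ ENNReal.ofReal c' * ∑' i : ℕ, ENNReal.ofReal ((M ^ (k + i)) ^ (θ - 1)) *
              ∫⁻ s in I (k + i), g s := by
            gcongr; exact hardy_dyadic hmn hM g k ht.1
        _ = _ := by
            rw [← ENNReal.tsum_mul_left]
            refine tsum_congr fun i => ?_
            rw [← mul_assoc, ← ENNReal.ofReal_mul hc'0.le]
            congr 2
            rw [hc', Real.mul_rpow (zpow_pos hM0 _).le hM1.le]; ring
    refine (eext_mono (fun x y => young_mono hB) h1).trans ((eext_tsum hB hpos hfin _).trans ?_)
    refine ENNReal.tsum_le_tsum fun i => ?_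
    refine (eext_double hK hK2 (i + 2) _).trans ?_
    gcongr
    exact hp (k + i)
  have hIntK : ∀ k : ℤ, ∫⁻ t in I k, eext B (ENNReal.ofReal c' * hardyOp m n g t) ≤
      ENNReal.ofReal (K ^ 2) * ∑' i : ℕ, 2⁻¹ ^ i * e (k + i) := by
    intro k
    calc _ ≤ ∫⁻ t in I k, ∑' i : ℕ, ENNReal.ofReal K ^ (i + 2) *
        (e (k + i) / ENNReal.ofReal (M ^ (k + i) * (M - 1))) :=
          setLIntegral_mono' measurableSet_Ico (hpt k)
      _ = (∑' i : ℕ, ENNReal.ofReal K ^ (i + 2) *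
        (e (k + i) / ENNReal.ofReal (M ^ (k + i) * (M - 1)))) * ENNReal.ofReal (M ^ k * (M - 1)) := by
          rw [setLIntegral_const, hvol]
      _ = _ := by
          rw [← ENNReal.tsum_mul_right, ← ENNReal.tsum_mul_left]
          refine tsum_congr fun i => ?_
          rw [div_eq_mul_inv, ← ENNReal.ofReal_inv_of_pos (hLpos _), ← ENNReal.ofReal_pow (by linarith)]
          have e2 : (2⁻¹ : ℝ≥0∞) = ENNReal.ofReal 2⁻¹ := by
            rw [ENNReal.ofReal_inv_of_pos two_pos]; simp
          rw [e2, ← ENNReal.ofReal_pow (by norm_num)]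
          have e3 : K ^ (i + 2) * (M ^ (k + i) * (M - 1))⁻¹ * (M ^ k * (M - 1)) =
              K ^ 2 * 2⁻¹ ^ i := by
            rw [zpow_add₀ hM0.ne', zpow_natCast, hMdef, mul_pow, inv_pow]
            have := (zpow_pos (by positivity : 0 < 2 * K) k).ne'
            have h3 : 2 * K - 1 ≠ 0 := by linarith
            field_simp
            ring
          have h4 := (hLpos (k+i))
          calc _ = ENNReal.ofReal (K ^ (i + 2)) * ENNReal.ofReal ((M ^ (k + i) * (M - 1))⁻¹) *
                ENNReal.ofReal (M ^ k * (M - 1)) * e (k + i) := by ring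
            _ = ENNReal.ofReal (K ^ 2 * 2⁻¹ ^ i) * e (k + i) := by
                rw [← ENNReal.ofReal_mul (by positivity), ← ENNReal.ofReal_mul (by positivity), e3]
            _ = _ := by rw [ENNReal.ofReal_mul (by positivity), mul_assoc]
  have htot : ∫⁻ t in Ioi (0:ℝ), eext B (ENNReal.ofReal c' * hardyOp m n g t) ≤
      ENNReal.ofReal N := by
    rw [← dyadic_union hM]
    refine (lintegral_iUnion_le _ _).trans ?_
    calc _ ≤ ∑' k : ℤ, ENNReal.ofReal (K ^ 2) * ∑' i : ℕ, 2⁻¹ ^ i * e (k + i) :=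
          ENNReal.tsum_le_tsum hIntK
      _ = ENNReal.ofReal (K ^ 2) * ∑' i : ℕ, 2⁻¹ ^ i * ∑' k : ℤ, e (k + i) := by
          rw [ENNReal.tsum_mul_left, ENNReal.tsum_comm]
          simp_rw [ENNReal.tsum_mul_left]
      _ = ENNReal.ofReal (K ^ 2) * ∑' i : ℕ, 2⁻¹ ^ i * ∑' k : ℤ, e k := by
          congr 1
          refine tsum_congr fun i => ?_
          congr 1
          exact (Equiv.addRight (i:ℤ)).tsum_eq e
      _ ≤ ENNReal.ofReal (K ^ 2) * ∑' i : ℕ, 2⁻¹ ^ i * 1 := by gcongr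
      _ = ENNReal.ofReal N := by
          simp only [mul_one]
          rw [ENNReal.tsum_geometric, ENNReal.one_sub_inv_two, inv_inv, hN, mul_comm,
            ENNReal.ofReal_mul two_pos.le]
          simp
  calc _ ≤ ∫⁻ t in Ioi (0:ℝ), ENNReal.ofReal N⁻¹ *
        eext B (ENNReal.ofReal c' * hardyOp m n g t) := by
        refine lintegral_mono fun t => ?_
        rw [ENNReal.ofReal_mul (by positivity), mul_assoc]
        exact eext_scale hB (by positivity) (inv_le_one_of_one_le₀ hN1) _
    _ ≤ ENNReal.ofReal N⁻¹ * ENNReal.ofReal N := by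
        rw [lintegral_const_mul' _ _ ENNReal.ofReal_ne_top]; gcongr
    _ = 1 := by
        rw [← ENNReal.ofReal_mul (by positivity), inv_mul_cancel₀ (by positivity)]; simp

lemma hardy_norm {m n : ℕ} (hm : 1 ≤ m) (hmn : m < n) {B : ℝ → ℝ≥0∞} (hB : IsYoung B)
    (hpos : ∀ x, 0 < x → B x ≠ 0) (hfin : ∀ x, 0 ≤ x → B x ≠ ∞)
    {K : ℝ} (hK : 1 ≤ K) (hK2 : ∀ x, 0 ≤ x → B (2 * x) ≤ ENNReal.ofReal K * B x) :
    ∃ C : ℝ≥0∞, 0 < C ∧ C < ∞ ∧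
          ∀ f : ℝ → ℝ≥0∞, Measurable f →
            luxNorm B (hardyOp m n f) ≤ C * luxNorm (Bm m n B) f := by
  obtain ⟨c, hc, h⟩ := hardy_modular hm hmn hB hpos hfin hK hK2
  have hc0 : ENNReal.ofReal c ≠ 0 := by simpa using hc
  refine ⟨(ENNReal.ofReal c)⁻¹, by simp, by simpa using hc, fun f _ => ?_⟩
  rw [mul_comm, ← div_eq_mul_inv, ENNReal.le_div_iff_mul_le (Or.inl hc0) (Or.inl ENNReal.ofReal_ne_top)]
  refine le_sInf fun l hl => ?_
  obtain ⟨hl0, hl1⟩ := hl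
  by_cases hlt : l = ∞
  · rw [hlt]; exact le_top
  rw [← ENNReal.le_div_iff_mul_le (Or.inl hc0) (Or.inl ENNReal.ofReal_ne_top)]
  refine sInf_le ⟨?_, ?_⟩
  · exact ENNReal.div_ne_zero.2 ⟨hl0, ENNReal.ofReal_ne_top⟩
  · have h1 := h (fun t => f t / l) hl1
    refine le_trans (le_of_eq ?_) h1
    refine lintegral_congr fun t => ?_
    congr 1
    have e : hardyOp m n (fun t => f t / l) t = hardyOp m n f t * l⁻¹ := by
      unfold hardyOp
      rw [← lintegral_mul_const' _ _ (ENNReal.inv_ne_top.2 hl0)]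
      refine lintegral_congr fun s => ?_
      beta_reduce; rw [ENNReal.div_eq_inv_mul]; ring
    rw [e, div_eq_mul_inv, div_eq_mul_inv,
      ENNReal.mul_inv (Or.inl hl0) (Or.inl hlt), inv_inv]
    ring

lemma hardy_test {m n : ℕ} (hmn : m < n) {A B : ℝ → ℝ≥0∞} (hA : IsYoung A) (hB : IsYoung B)
    (hpos : ∀ x, 0 < x → B x ≠ 0) (hfin : ∀ x, 0 ≤ x → B x ≠ ∞)
    (hH : ∃ C : ℝ≥0∞, 0 < C ∧ C < ∞ ∧
            ∀ f : ℝ → ℝ≥0∞, Measurable f →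
              luxNorm B (hardyOp m n f) ≤ C * luxNorm A f) :
    ∃ C : ℝ, 0 < C ∧ ∀ y s : ℝ, 0 ≤ y → 0 < s → A y ≤ ENNReal.ofReal s →
      ENNReal.ofReal (y * s ^ (-((m:ℝ)/n)) / C) ≤ geninv B (ENNReal.ofReal s) := by
  obtain ⟨C, hC0, hCt, hH⟩ := hH
  set D := C.toReal with hD
  have hD0 : 0 < D := ENNReal.toReal_pos hC0.ne' hCt.ne
  have hCD : C = ENNReal.ofReal D := (ENNReal.ofReal_toReal hCt.ne).symm
  refine ⟨8 * D, by positivity, fun y s hy hs hAy => ?_⟩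
  set θ : ℝ := (m:ℝ)/n with hθ
  have hn0 : (0:ℝ) < n := by
    have : 0 < n := by omega
    positivity
  have hθ1 : θ - 1 ≤ 0 := by
    have : θ ≤ 1 := by
      rw [hθ, div_le_one hn0]
      exact_mod_cast hmn.le
    linarith
  set R : ℝ := s⁻¹ with hR
  have hR0 : 0 < R := inv_pos.2 hs
  set f : ℝ → ℝ≥0∞ := (Ioc 0 R).indicator (fun _ => ENNReal.ofReal y) with hf
  have hfm : Measurable f := measurable_const.indicator measurableSet_Ioc
  have hfA : luxNorm A f ≤ 1 := by
    refine sInf_le ⟨one_ne_zero, ?_⟩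
    calc _ ≤ ∫⁻ t, (Ioc 0 R).indicator (fun _ => A y) t := by
          refine (setLIntegral_le_lintegral _ _).trans (lintegral_mono fun t => ?_)
          simp only [hf, div_one, indicator]
          split_ifs
          · rw [eext_ofReal hy]
          · simp [eext, hA.map_zero]
      _ = A y * ENNReal.ofReal R := by
          rw [lintegral_indicator measurableSet_Ioc, setLIntegral_const, Real.volume_Ioc, sub_zero]
      _ ≤ ENNReal.ofReal s * ENNReal.ofReal R := by gcongr
      _ = 1 := by rw [← ENNReal.ofReal_mul hs.le, hR, mul_inv_cancel₀ hs.ne']; simp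
  have h1 : luxNorm B (hardyOp m n f) < ENNReal.ofReal (2 * D) := by
    refine (hH f hfm).trans_lt ?_
    calc C * luxNorm A f ≤ C * 1 := by gcongr
      _ = ENNReal.ofReal D := by rw [mul_one, hCD]
      _ < _ := (ENNReal.ofReal_lt_ofReal_iff (by positivity)).2 (by linarith)
  obtain ⟨l, ⟨hl0, hl1⟩, hl2⟩ := sInf_lt_iff.1 h1
  set z : ℝ := y * (R ^ θ / 2) / (2 * D) with hz
  have hRθ := Real.rpow_pos_of_pos hR0 θ
  have hz0 : 0 ≤ z := by positivity
  have hlow : ∀ t ∈ Ioc 0 (R/2), B z ≤ eext B (hardyOp m n f t / l) := by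
    intro t ht
    rw [← eext_ofReal (B := B) hz0]
    refine eext_mono (fun x y => young_mono hB) ?_
    have h2 : ENNReal.ofReal (y * (R ^ θ / 2)) ≤ hardyOp m n f t := by
      unfold hardyOp
      calc ENNReal.ofReal (y * (R ^ θ / 2)) = ∫⁻ x in Ioc (R/2) R, ENNReal.ofReal (y * R ^ (θ - 1)) := by
            rw [setLIntegral_const, Real.volume_Ioc, ← ENNReal.ofReal_mul (by positivity)]
            congr 1
            have : R ^ θ = R ^ (θ - 1) * R := by
              nth_rewrite 3 [← Real.rpow_one R]
              rw [← Real.rpow_add hR0]; ring_nf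
            rw [this]; ring
        _ ≤ ∫⁻ x in Ioc (R/2) R, f x * ENNReal.ofReal (x ^ (θ - 1)) := by
            refine setLIntegral_mono' measurableSet_Ioc fun x hx => ?_
            have hx0 : 0 < x := by linarith [hx.1]
            have hxm : x ∈ Ioc 0 R := ⟨hx0, hx.2⟩
            rw [hf, indicator_of_mem hxm, ENNReal.ofReal_mul hy]
            exact mul_le_mul' le_rfl (ENNReal.ofReal_le_ofReal
              (Real.rpow_le_rpow_of_nonpos hx0 hx.2 hθ1))
        _ ≤ _ := lintegral_mono_set fun x hx => lt_of_le_of_lt ht.2 hx.1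
    calc ENNReal.ofReal z = ENNReal.ofReal (y * (R ^ θ / 2)) / ENNReal.ofReal (2 * D) := by
          rw [hz, ENNReal.ofReal_div_of_pos (by positivity)]
      _ ≤ _ := ENNReal.div_le_div h2 hl2.le
  have h3 : B z * ENNReal.ofReal (R/2) ≤ 1 := by
    calc B z * ENNReal.ofReal (R/2) = ∫⁻ t in Ioc 0 (R/2), B z := by
          rw [setLIntegral_const, Real.volume_Ioc, sub_zero]
      _ ≤ ∫⁻ t in Ioc 0 (R/2), eext B (hardyOp m n f t / l) :=
          setLIntegral_mono' measurableSet_Ioc hlow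
      _ ≤ ∫⁻ t in Ioi 0, eext B (hardyOp m n f t / l) := lintegral_mono_set fun x hx => hx.1
      _ ≤ 1 := hl1
  have h4 : B (1/2 * z) ≤ ENNReal.ofReal s := by
    calc B (1/2 * z) ≤ ENNReal.ofReal (1/2) * B z :=
          young_scale hB (by norm_num) (by norm_num) hz0
      _ = ENNReal.ofReal s * (B z * ENNReal.ofReal (R/2)) := by
          rw [mul_left_comm, ← ENNReal.ofReal_mul hs.le, mul_comm]
          congr 2; rw [hR]; field_simp
      _ ≤ ENNReal.ofReal s * 1 := by gcongr
      _ = _ := mul_one _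
  refine le_trans (le_of_eq ?_) (young_le_geninv hB hpos hfin h4)
  congr 1
  rw [hz, hR, Real.rpow_neg hs.le, Real.inv_rpow hs.le]
  field_simp
  ring

lemma Bm_le_of_hardy {m n : ℕ} (hmn : m < n) {A B : ℝ → ℝ≥0∞} (hA : IsYoung A) (hB : IsYoung B)
    (hpos : ∀ x, 0 < x → B x ≠ 0) (hfin : ∀ x, 0 ≤ x → B x ≠ ∞)
    (hH : ∃ C : ℝ≥0∞, 0 < C ∧ C < ∞ ∧
            ∀ f : ℝ → ℝ≥0∞, Measurable f →
              luxNorm B (hardyOp m n f) ≤ C * luxNorm A f) :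
    ∃ C : ℝ, 0 < C ∧ ∀ x : ℝ, 0 ≤ x → Bm m n B x ≤ A (C * x) := by
  obtain ⟨C, hC, h⟩ := hardy_test hmn hA hB hpos hfin hH
  refine ⟨C, hC, fun x hx => ?_⟩
  rcases hx.eq_or_lt with rfl | hx
  · simp [Bm_zero]
  by_cases hAt : A (C * x) = ∞
  · rw [hAt]; exact le_top
  have key : ∀ u : ℝ, 0 < u → A (C * x) ≤ ENNReal.ofReal u → Bm m n B x ≤ ENNReal.ofReal u := by
    intro u hu hAu
    refine Bm_upper hx hu.le (le_Gm hu fun r hr hru => ?_)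
    have h1 : A (r / u * (C * x)) ≤ ENNReal.ofReal r := by
      calc _ ≤ ENNReal.ofReal (r / u) * A (C * x) :=
            young_scale hA (by positivity) (by rw [div_le_one hu]; exact hru) (by positivity)
        _ ≤ ENNReal.ofReal (r / u) * ENNReal.ofReal u := by gcongr
        _ = _ := by rw [← ENNReal.ofReal_mul (by positivity), div_mul_cancel₀ _ hu.ne']
    have h2 := h _ r (by positivity) hr h1
    calc ENNReal.ofReal x = ENNReal.ofReal u * (ENNReal.ofReal (r / u * (C * x) *
          r ^ (-((m:ℝ)/n)) / C) * ENNReal.ofReal (r ^ (((m : ℝ) - (n : ℝ))/(n : ℝ)))) := by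
          have hr1 := Real.rpow_pos_of_pos hr ((m:ℝ)/n)
          rw [← ENNReal.ofReal_mul (by positivity), ← ENNReal.ofReal_mul (by positivity),
            exp_eq hmn, Real.rpow_neg hr.le, Real.rpow_sub_one hr.ne']
          congr 1
          field_simp
      _ ≤ _ := by gcongr
  refine ENNReal.le_of_forall_pos_le_add fun ε hε _ => ?_
  have h3 := key ((A (C * x)).toReal + ε) (by positivity) (by
    rw [ENNReal.ofReal_add ENNReal.toReal_nonneg (NNReal.coe_nonneg ε), ENNReal.ofReal_toReal hAt]
    exact le_self_add)
  refine h3.trans (le_of_eq ?_)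
  rw [ENNReal.ofReal_add ENNReal.toReal_nonneg (NNReal.coe_nonneg ε), ENNReal.ofReal_toReal hAt]
  simp

lemma lux_of_dom {A F : ℝ → ℝ≥0∞} {C : ℝ} (hC : 0 < C)
    (h : ∀ x : ℝ, 0 ≤ x → F x ≤ A (C * x)) (f : ℝ → ℝ≥0∞) (hf : luxNorm A f < ∞) :
    luxNorm F f < ∞ := by
  obtain ⟨l, ⟨hl0, hl1⟩, hl2⟩ := sInf_lt_iff.1 hf
  have hC0 : ENNReal.ofReal C ≠ 0 := by simpa using hC
  refine lt_of_le_of_lt (sInf_le (a := l * ENNReal.ofReal C) ⟨mul_ne_zero hl0 hC0, ?_⟩)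
    (ENNReal.mul_lt_top hl2 ENNReal.ofReal_lt_top)
  refine le_trans (lintegral_mono fun t => ?_) hl1
  show eext F (f t / (l * ENNReal.ofReal C)) ≤ eext A (f t / l)
  have e : f t / l = ENNReal.ofReal C * (f t / (l * ENNReal.ofReal C)) := by
    rw [div_eq_mul_inv, div_eq_mul_inv, ENNReal.mul_inv (Or.inl hl0) (Or.inl hl2.ne),
      mul_comm (ENNReal.ofReal C), mul_assoc, mul_assoc,
      ENNReal.inv_mul_cancel hC0 ENNReal.ofReal_ne_top, mul_one]
  rw [e]
  generalize f t / (l * ENNReal.ofReal C) = x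
  induction x with
  | top => simp [eext, ENNReal.mul_top hC0]
  | coe x =>
    have e : (x : ℝ≥0∞) = ENNReal.ofReal x := by simp
    rw [e, ← ENNReal.ofReal_mul hC.le, eext_ofReal (NNReal.coe_nonneg x), eext_ofReal (by positivity)]
    exact h x x.2


/-- the function whose running infimum defines `Gm` -/
def kap (m n : ℕ) (B : ℝ → ℝ≥0∞) (r : ℝ) : ℝ≥0∞ :=
  geninv B (ENNReal.ofReal r) * ENNReal.ofReal (r ^ (((m : ℝ) - (n : ℝ))/(n : ℝ)))

lemma PL_mul_rpow {a b t : ℝ} (c : ℝ) (ht : 0 < t) : PL a b t * t ^ c = PL (a + c) b t := by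
  unfold PL
  rw [Real.rpow_add ht]; ring

lemma PL_anti_zero {e b : ℝ} (h : e < 0 ∨ (e = 0 ∧ 0 ≤ b)) :
    ∃ C : ℝ, 0 < C ∧ ∀ s t : ℝ, 0 < s → s ≤ t → t ≤ 1 → PL e b t ≤ C * PL e b s := by
  rcases h with h | ⟨rfl, hb⟩
  · obtain ⟨C, hC, h1⟩ := PL_almost_anti (neg_pos.2 h) b
    rw [neg_neg] at h1
    exact ⟨C, hC, fun s t hs hst _ => h1 s t hs hst⟩
  · refine ⟨1, one_pos, fun s t hs hst ht1 => ?_⟩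
    have ht : 0 < t := hs.trans_le hst
    unfold PL
    rw [Real.rpow_zero, Real.rpow_zero, one_mul, one_mul, one_mul]
    refine Real.rpow_le_rpow (LL_pos t).le ?_ hb
    unfold LL
    rw [abs_of_nonpos (Real.log_nonpos ht.le ht1),
      abs_of_nonpos (Real.log_nonpos hs.le (hst.trans ht1))]
    linarith [Real.log_le_log hs hst]

lemma PL_anti_inf {e b : ℝ} (h : e < 0 ∨ (e = 0 ∧ b ≤ 0)) :
    ∃ C : ℝ, 0 < C ∧ ∀ s t : ℝ, 1 ≤ s → s ≤ t → PL e b t ≤ C * PL e b s := by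
  rcases h with h | ⟨rfl, hb⟩
  · obtain ⟨C, hC, h1⟩ := PL_almost_anti (neg_pos.2 h) b
    rw [neg_neg] at h1
    exact ⟨C, hC, fun s t hs hst => h1 s t (by linarith) hst⟩
  · refine ⟨1, one_pos, fun s t hs hst => ?_⟩
    unfold PL
    rw [Real.rpow_zero, Real.rpow_zero, one_mul, one_mul, one_mul]
    refine Real.rpow_le_rpow_of_nonpos (LL_pos s) ?_ hb
    unfold LL
    rw [abs_of_nonneg (Real.log_nonneg hs), abs_of_nonneg (Real.log_nonneg (hs.trans hst))]
    linarith [Real.log_le_log (by linarith) hst]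

lemma PL_one (e b : ℝ) : PL e b 1 = 1 := by simp [PL, LL]

lemma PL_neg {e b t : ℝ} (ht : 0 < t) : PL e b t * PL (-e) (-b) t = 1 := by
  have h1 := Real.rpow_pos_of_pos ht e
  have h2 := Real.rpow_pos_of_pos (LL_pos t) b
  unfold PL
  rw [Real.rpow_neg ht.le, Real.rpow_neg (LL_pos t).le]
  field_simp

lemma kap_Cmp {l : Filter ℝ} (hl : l = 𝓝[>] 0 ∨ l = atTop) {m n : ℕ} (hmn : m < n)
    {B : ℝ → ℝ≥0∞} {e b : ℝ} (h : Cmp l e b (fun y => geninv B (ENNReal.ofReal y))) :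
    Cmp l (e + ((m:ℝ)/n - 1)) b (kap m n B) := by
  obtain ⟨c, C, hc, hC, h⟩ := h
  refine ⟨c, C, hc, hC, ?_⟩
  filter_upwards [h, filt_pos hl] with t h1 ht
  have h2 := PL_pos (a := e) (b := b) ht
  unfold kap
  rw [exp_eq hmn, ← PL_mul_rpow _ ht, ← mul_assoc, ← mul_assoc,
    ENNReal.ofReal_mul (p := c * PL e b t) (by positivity),
    ENNReal.ofReal_mul (p := C * PL e b t) (by positivity)]
  exact ⟨mul_le_mul' h1.1 le_rfl, mul_le_mul' h1.2 le_rfl⟩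

lemma Gm_Cmp {l : Filter ℝ} (hl : l = 𝓝[>] 0 ∨ l = atTop) {m n : ℕ} 
    {B : ℝ → ℝ≥0∞} {e b : ℝ} (h : Cmp l e b (kap m n B))
    {D : ℝ} (hD : 0 < D)
    (h2 : ∀ᶠ u in l, ∀ r, 0 < r → r ≤ u → ENNReal.ofReal (D * PL e b u) ≤ kap m n B r) :
    Cmp l (e + 1) b (Gm m n B) := by
  obtain ⟨c, C, hc, hC, h⟩ := h
  refine ⟨D, C, hD, hC, ?_⟩
  filter_upwards [h, filt_pos hl, h2] with t h1 ht h2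
  have e1 : ∀ x, x * PL (e+1) b t = t * (x * PL e b t) := by
    intro x
    rw [← PL_mul_rpow _ ht, Real.rpow_one]; ring
  rw [e1, e1, ENNReal.ofReal_mul ht.le, ENNReal.ofReal_mul ht.le]
  constructor
  · exact le_Gm ht fun r hr hrt => mul_le_mul' le_rfl (h2 r hr hrt)
  · exact (Gm_le ht le_rfl).trans (mul_le_mul' le_rfl h1.2)

lemma kap_low_zero {m n : ℕ} {B : ℝ → ℝ≥0∞} {e b : ℝ} (h : Cmp (𝓝[>] 0) e b (kap m n B))
    (he : e < 0 ∨ (e = 0 ∧ 0 ≤ b)) :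
    ∃ D t0 : ℝ, 0 < D ∧ 0 < t0 ∧ ∀ u, u ≤ t0 → ∀ r, 0 < r → r ≤ u →
      ENNReal.ofReal (D * PL e b u) ≤ kap m n B r := by
  obtain ⟨c, C, hc, hC, h⟩ := h
  obtain ⟨t0, ht0, h⟩ := ev_zero h
  obtain ⟨K, hK, h1⟩ := PL_anti_zero he
  refine ⟨c / K, min t0 1, by positivity, by positivity, fun u hu r hr hru => ?_⟩
  refine le_trans (ENNReal.ofReal_le_ofReal ?_) (h r hr (hru.trans (hu.trans (min_le_left _ _)))).1
  have h2 := h1 r u hr hru (hu.trans (min_le_right _ _))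
  calc c / K * PL e b u ≤ c / K * (K * PL e b r) := by gcongr
    _ = _ := by field_simp

lemma kap_low {m n : ℕ} (hmn : m < n) {B : ℝ → ℝ≥0∞} (hB : IsYoung B)
    (hpos : ∀ x, 0 < x → B x ≠ 0) (hfin : ∀ x, 0 ≤ x → B x ≠ ∞)
    {e b : ℝ} (h : Cmp (𝓝[>] 0) e b (kap m n B))
    (he : e < 0 ∨ (e = 0 ∧ 0 ≤ b)) {T : ℝ} (hT : 0 < T) :
    ∃ d : ℝ, 0 < d ∧ ∀ r, 0 < r → r ≤ T → ENNReal.ofReal d ≤ kap m n B r := by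
  obtain ⟨D, t0, hD, ht0, h⟩ := kap_low_zero h he
  set β := (geninv B (ENNReal.ofReal t0)).toReal with hβ
  have hβ0 : 0 < β := ENNReal.toReal_pos (young_geninv_ne_zero hB hpos hfin ht0)
    (young_geninv_ne_top hB hpos)
  have hβ' : geninv B (ENNReal.ofReal t0) = ENNReal.ofReal β :=
    (ENNReal.ofReal_toReal (young_geninv_ne_top hB hpos)).symm
  have hn0 : (0:ℝ) < n := by
    have : 0 < n := by omega
    positivity
  have hx : ((m : ℝ) - (n : ℝ))/(n : ℝ) ≤ 0 := by
    apply div_nonpos_of_nonpos_of_nonneg _ hn0.le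
    have : (m:ℝ) ≤ n := by exact_mod_cast hmn.le
    linarith
  have hP := PL_pos (a := e) (b := b) ht0
  have hTx := Real.rpow_pos_of_pos hT (((m : ℝ) - (n : ℝ))/(n : ℝ))
  refine ⟨min (D * PL e b t0) (β * T ^ (((m : ℝ) - (n : ℝ))/(n : ℝ))), by positivity,
    fun r hr hrT => ?_⟩
  rcases le_total r t0 with h1 | h1
  · exact (ENNReal.ofReal_le_ofReal (min_le_left _ _)).trans (h t0 le_rfl r hr h1)
  · refine (ENNReal.ofReal_le_ofReal (min_le_right _ _)).trans ?_
    rw [ENNReal.ofReal_mul hβ0.le, ← hβ']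
    exact mul_le_mul' (geninv_mono B (ENNReal.ofReal_le_ofReal h1))
      (ENNReal.ofReal_le_ofReal (Real.rpow_le_rpow_of_nonpos hr hrT hx))

lemma kap_low_inf {m n : ℕ} {B : ℝ → ℝ≥0∞}
    (hlow : ∀ T : ℝ, 0 < T → ∃ d : ℝ, 0 < d ∧ ∀ r, 0 < r → r ≤ T → ENNReal.ofReal d ≤ kap m n B r)
    {e b : ℝ} (h : Cmp atTop e b (kap m n B))
    (he : e < 0 ∨ (e = 0 ∧ b ≤ 0)) :
    ∃ D : ℝ, 0 < D ∧ ∀ᶠ u in atTop, ∀ r, 0 < r → r ≤ u →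
      ENNReal.ofReal (D * PL e b u) ≤ kap m n B r := by
  obtain ⟨c, C, hc, hC, h⟩ := h
  obtain ⟨t1, h⟩ := eventually_atTop.1 h
  obtain ⟨K, hK, h1⟩ := PL_anti_inf he
  set T := max t1 1 with hT
  have hT1 : 1 ≤ T := le_max_right _ _
  obtain ⟨d, hd, h2⟩ := hlow T (by linarith)
  refine ⟨min (c / K) (d / K), by positivity, ?_⟩
  filter_upwards [eventually_ge_atTop 1] with u hu r hr hru
  have hu0 : 0 < u := by linarith
  have hP := PL_pos (a := e) (b := b) hu0
  rcases le_total r T with h3 | h3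
  · refine le_trans (ENNReal.ofReal_le_ofReal ?_) (h2 r hr h3)
    have h4 := h1 1 u le_rfl hu
    rw [PL_one, mul_one] at h4
    calc _ ≤ d / K * PL e b u := by gcongr; exact min_le_right _ _
      _ ≤ d / K * K := by gcongr
      _ = d := by field_simp
  · refine le_trans (ENNReal.ofReal_le_ofReal ?_) (h r ((le_max_left _ _).trans h3)).1
    have h4 := h1 r u (hT1.trans h3) hru
    calc _ ≤ c / K * PL e b u := by gcongr; exact min_le_left _ _
      _ ≤ c / K * (K * PL e b r) := by gcongr
      _ = _ := by field_simp

lemma kap_low_all {m n : ℕ} {B : ℝ → ℝ≥0∞}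
    (hlow : ∀ T : ℝ, 0 < T → ∃ d : ℝ, 0 < d ∧ ∀ r, 0 < r → r ≤ T → ENNReal.ofReal d ≤ kap m n B r)
    {e b : ℝ} (h : Cmp atTop e b (kap m n B))
    (he : 0 < e ∨ (e = 0 ∧ 0 ≤ b)) :
    ∃ D : ℝ, 0 < D ∧ ∀ r, 0 < r → ENNReal.ofReal D ≤ kap m n B r := by
  obtain ⟨c, C, hc, hC, h⟩ := h
  obtain ⟨t1, h⟩ := eventually_atTop.1 h
  obtain ⟨K, hK, h1⟩ := PL_anti_inf (e := -e) (b := -b) (by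
    rcases he with he | ⟨rfl, he⟩
    · left; linarith
    · right; exact ⟨by simp, by linarith⟩)
  set T := max t1 1 with hT
  have hT1 : 1 ≤ T := le_max_right _ _
  obtain ⟨d, hd, h2⟩ := hlow T (by linarith)
  refine ⟨min d (c / K), by positivity, fun r hr => ?_⟩
  rcases le_total r T with h3 | h3
  · exact (ENNReal.ofReal_le_ofReal (min_le_left _ _)).trans (h2 r hr h3)
  · refine (ENNReal.ofReal_le_ofReal ((min_le_right _ _).trans ?_)).trans
      (h r ((le_max_left _ _).trans h3)).1
    have h4 := h1 1 r le_rfl (hT1.trans h3)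
    rw [PL_one, mul_one] at h4
    have h5 := PL_neg (e := e) (b := b) hr
    have hP := PL_pos (a := e) (b := b) hr
    have h6 : 1 ≤ PL e b r * K := by
      rw [← h5]; gcongr
    rw [div_le_iff₀ hK]
    nlinarith

lemma Gm_Cmp_lin {m n : ℕ} {B : ℝ → ℝ≥0∞} (hB : IsYoung B)
    (hpos : ∀ x, 0 < x → B x ≠ 0)
    {D : ℝ} (hD : 0 < D) (h : ∀ r, 0 < r → ENNReal.ofReal D ≤ kap m n B r) :
    Cmp atTop 1 0 (Gm m n B) := by
  have hfin : kap m n B 1 ≠ ∞ :=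
    ENNReal.mul_ne_top (young_geninv_ne_top hB hpos) ENNReal.ofReal_ne_top
  have h1 : D ≤ (kap m n B 1).toReal := by
    rw [← ENNReal.ofReal_le_iff_le_toReal hfin]; exact h 1 one_pos
  refine ⟨D, (kap m n B 1).toReal, hD, by linarith, ?_⟩
  filter_upwards [eventually_ge_atTop 1] with u hu
  have hu0 : 0 < u := by linarith
  have e1 : PL 1 0 u = u := by simp [PL]
  rw [e1, mul_comm D, mul_comm _ u, ENNReal.ofReal_mul hu0.le, ENNReal.ofReal_mul hu0.le,
    ENNReal.ofReal_toReal hfin]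
  exact ⟨le_Gm hu0 fun r hr _ => mul_le_mul' le_rfl (h r hr), Gm_le one_pos hu⟩

lemma not_exists_dom {m n : ℕ} (hmn : m < n) {B : ℝ → ℝ≥0∞} (hB : IsYoung B)
    (hpos : ∀ x, 0 < x → B x ≠ 0) (hfin : ∀ x, 0 ≤ x → B x ≠ ∞)
    {e b : ℝ} (h : Cmp (𝓝[>] 0) e b (kap m n B))
    (he : 0 < e ∨ (e = 0 ∧ b < 0)) : ¬ ExistsOrliczDomain m n B := by
  rintro ⟨A, hA, hH⟩
  obtain ⟨C, hC, hT⟩ := hardy_test hmn hA hB hpos hfin hH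
  obtain ⟨x0, hx0, hAx⟩ := hA.not_top
  set K : ℝ := (A x0).toReal / x0 + 1 with hK
  have hK0 : 0 < K := by
    have : 0 ≤ (A x0).toReal := ENNReal.toReal_nonneg
    positivity
  have key : ∀ s, 0 < s → s ≤ K * x0 → ENNReal.ofReal (1 / (K * C)) ≤ kap m n B s := by
    intro s hs hsx
    have h1 : A (s / K) ≤ ENNReal.ofReal s := by
      have e1 : s / K = s / (K * x0) * x0 := by field_simp
      rw [e1]
      refine (young_scale hA (by positivity) (by rw [div_le_one (by positivity)]; exact hsx)
        hx0.le).trans ?_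
      rw [← ENNReal.ofReal_toReal hAx, ← ENNReal.ofReal_mul (by positivity)]
      refine ENNReal.ofReal_le_ofReal ?_
      have h2 : (A x0).toReal ≤ K * x0 := by
        rw [hK]; field_simp; linarith
      calc s / (K * x0) * (A x0).toReal ≤ s / (K * x0) * (K * x0) := by gcongr
        _ = s := by field_simp
    have h2 := hT (s / K) s (by positivity) hs h1
    unfold kap
    refine le_trans ?_ (mul_le_mul' h2 le_rfl)
    have hr1 := Real.rpow_pos_of_pos hs ((m:ℝ)/n)
    rw [← ENNReal.ofReal_mul (by positivity)]
    refine ENNReal.ofReal_le_ofReal (le_of_eq ?_)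
    rw [exp_eq hmn, Real.rpow_neg hs.le, Real.rpow_sub_one hs.ne']
    field_simp
  obtain ⟨c, D, hc, hD, h⟩ := h
  have hlim : Tendsto (PL e b) (𝓝[>] 0) (𝓝 0) := by
    rcases he with he | ⟨rfl, hb⟩
    · exact (PL_tendsto_zero he b).mono_right nhdsWithin_le_nhds
    · have e1 : PL 0 b = (fun x : ℝ => x ^ (-(-b))) ∘ LL := by
        funext t; simp [PL]
      rw [e1]
      refine (tendsto_rpow_neg_atTop (neg_pos.2 hb)).comp ?_
      unfold LL
      exact tendsto_atTop_add_const_left _ _ (tendsto_abs_atBot_atTop.comp Real.tendsto_log_nhdsGT_zero)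
  have hlt : ∀ᶠ t in 𝓝[>] (0:ℝ), PL e b t < 1 / (K * C) / D :=
    hlim.eventually (gt_mem_nhds (by positivity))
  obtain ⟨s, ⟨h1, h2⟩, h3⟩ := ((h.and hlt).and
    (Ioc_mem_nhdsGT (by positivity : 0 < K * x0))).exists
  have h4 := (key s h3.1 h3.2).trans h1.2
  have hP := PL_pos (a := e) (b := b) h3.1
  rw [ENNReal.ofReal_le_ofReal_iff (by positivity)] at h4
  rw [lt_div_iff₀ hD] at h2
  linarith

lemma crit_eq {m n : ℕ} (hmn : m < n) {p : ℝ} (hp : 1 ≤ p) :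
    ((n : ℝ)/((n : ℝ) - (m : ℝ)) < p ↔ 1/p + ((m:ℝ)/n - 1) < 0) ∧
    (p = (n : ℝ)/((n : ℝ) - (m : ℝ)) ↔ 1/p + ((m:ℝ)/n - 1) = 0) ∧
    (p < (n : ℝ)/((n : ℝ) - (m : ℝ)) ↔ 0 < 1/p + ((m:ℝ)/n - 1)) := by
  have hp0 : 0 < p := by linarith
  have hn0 : (0:ℝ) < n := by
    have : 0 < n := by omega
    positivity
  have hd : (0:ℝ) < (n:ℝ) - m := by
    have : (m:ℝ) < n := by exact_mod_cast hmn
    linarith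
  have e : 1/p + ((m:ℝ)/n - 1) = (n - p * (n - m)) / (p * n) := by field_simp; ring
  rw [e]
  have hpn : 0 < p * n := by positivity
  refine ⟨?_, ?_, ?_⟩
  · rw [div_lt_iff₀ hd, div_neg_iff]
    constructor
    · intro h; right; exact ⟨by linarith, hpn⟩
    · rintro (h | h) <;> linarith [h.1, h.2]
  · rw [eq_div_iff hd.ne', div_eq_zero_iff]
    constructor
    · intro h; left; linarith
    · rintro (h | h) <;> linarith
  · rw [lt_div_iff₀ hd, div_pos_iff]
    constructor
    · intro h; left; exact ⟨by linarith, hpn⟩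
    · rintro (h | h) <;> linarith [h.1, h.2]

lemma final_exp {m n : ℕ} (hmn : m < n) {p a : ℝ} (hp : 1 ≤ p) :
    0 < 1/p + ((m:ℝ)/n - 1) + 1 ∧ 0 < (n : ℝ) * p / ((n : ℝ) + (m : ℝ) * p) ∧
    1 / (1/p + ((m:ℝ)/n - 1) + 1) = (n : ℝ) * p / ((n : ℝ) + (m : ℝ) * p) ∧
    -(-a/p) / (1/p + ((m:ℝ)/n - 1) + 1) = (n : ℝ) * a / ((n : ℝ) + (m : ℝ) * p) := by
  have hp0 : 0 < p := by linarith
  have hn0 : (0:ℝ) < n := by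
    have : 0 < n := by omega
    positivity
  have hd : (0:ℝ) < n + m * p := by positivity
  have e : 1/p + ((m:ℝ)/n - 1) + 1 = (n + m * p) / (p * n) := by field_simp; ring
  rw [e]
  refine ⟨by positivity, by positivity, ?_, ?_⟩
  · field_simp
  · field_simp

lemma statement18_aux (n m : ℕ) (hm : 1 ≤ m) (hmn : m < n)
    (p0 pi a0 ai : ℝ) (hp0 : 1 ≤ p0) (hpi : 1 ≤ pi)
    (B : ℝ → ℝ≥0∞) (hB : IsYoung B)
    (hB0 : EquivNearZero B (modelZero p0 a0)) (hBi : EquivNearInfty B (modelInf pi ai)) :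
    (((p0 = (n : ℝ)/((n : ℝ) - (m : ℝ)) ∧ a0 ≤ 0) ∨ (n : ℝ)/((n : ℝ) - (m : ℝ)) < p0) →
      EquivNearZero (Bm m n B)
        (modelZero ((n : ℝ) * p0 / ((n : ℝ) + (m : ℝ) * p0))
          ((n : ℝ) * a0 / ((n : ℝ) + (m : ℝ) * p0)))
      ∧ (((n : ℝ)/((n : ℝ) - (m : ℝ)) < pi ∨
            (pi = (n : ℝ)/((n : ℝ) - (m : ℝ)) ∧ 0 < ai)) →
          EquivNearInfty (Bm m n B)
            (modelInf ((n : ℝ) * pi / ((n : ℝ) + (m : ℝ) * pi))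
              ((n : ℝ) * ai / ((n : ℝ) + (m : ℝ) * pi))))
      ∧ (((pi = (n : ℝ)/((n : ℝ) - (m : ℝ)) ∧ ai ≤ 0) ∨ pi < (n : ℝ)/((n : ℝ) - (m : ℝ))) →
          EquivNearInfty (Bm m n B) (fun t => ENNReal.ofReal t))
      ∧ (∃ C : ℝ≥0∞, 0 < C ∧ C < ∞ ∧
          ∀ f : ℝ → ℝ≥0∞, Measurable f →
            luxNorm B (hardyOp m n f) ≤ C * luxNorm (Bm m n B) f)
      ∧ (∀ A : ℝ → ℝ≥0∞, IsYoung A →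
          (∃ C : ℝ≥0∞, 0 < C ∧ C < ∞ ∧
            ∀ f : ℝ → ℝ≥0∞, Measurable f →
              luxNorm B (hardyOp m n f) ≤ C * luxNorm A f) →
          ∀ f : ℝ → ℝ≥0∞, Measurable f → luxNorm A f < ∞ → luxNorm (Bm m n B) f < ∞))
    ∧
    (((p0 = (n : ℝ)/((n : ℝ) - (m : ℝ)) ∧ 0 < a0) ∨ p0 < (n : ℝ)/((n : ℝ) - (m : ℝ))) →
      ¬ ExistsOrliczDomain m n B) := by
  have hp0' : 0 < p0 := by linarith
  have hpi' : 0 < pi := by linarith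
  have c0 := equivZero_to_Cmp hB0
  have ci := equivInf_to_Cmp hBi
  have hpos := pos_of_Cmp hB c0
  have hfin := fin_of_Cmp hB ci
  have k0 := kap_Cmp (Or.inl rfl) hmn (Cmp_geninv (Or.inl rfl) hp0' hB hpos hfin c0)
  have ki := kap_Cmp (Or.inr rfl) hmn (Cmp_geninv (Or.inr rfl) hpi' hB hpos hfin ci)
  obtain ⟨q1, q2, q3⟩ := crit_eq hmn hp0
  obtain ⟨r1, r2, r3⟩ := crit_eq hmn hpi
  obtain ⟨x1, x2, x3, x4⟩ := final_exp (a := a0) hmn hp0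
  obtain ⟨y1, y2, y3, y4⟩ := final_exp (a := ai) hmn hpi
  refine ⟨fun h0 => ?_, fun h0 => ?_⟩
  · have he : 1/p0 + ((m:ℝ)/n - 1) < 0 ∨ (1/p0 + ((m:ℝ)/n - 1) = 0 ∧ 0 ≤ -a0/p0) := by
      rcases h0 with ⟨h, h'⟩ | h
      · exact Or.inr ⟨q2.1 h, div_nonneg (by linarith) hp0'.le⟩
      · exact Or.inl (q1.1 h)
    have hlow : ∀ T : ℝ, 0 < T → ∃ d : ℝ, 0 < d ∧ ∀ r, 0 < r → r ≤ T →
        ENNReal.ofReal d ≤ kap m n B r := fun T hT => kap_low hmn hB hpos hfin k0 he hT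
    refine ⟨?_, fun hi => ?_, fun hi => ?_, ?_, ?_⟩
    · obtain ⟨D, t0, hD, ht0, h⟩ := kap_low_zero k0 he
      have g := Gm_Cmp (Or.inl rfl) k0 hD (by
        filter_upwards [Ioc_mem_nhdsGT ht0] with u hu using h u hu.2)
      have g2 := Cmp_Bm (Or.inl rfl) x1 hmn g
      rw [x3, x4] at g2
      exact Cmp_to_equivZero x2 Bm_zero g2
    · obtain ⟨D, hD, h⟩ := kap_low_inf hlow ki (by
        rcases hi with h | ⟨h, h'⟩
        · exact Or.inl (r1.1 h)
        · exact Or.inr ⟨r2.1 h, div_nonpos_of_nonpos_of_nonneg (by linarith) hpi'.le⟩)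
      have g := Gm_Cmp (Or.inr rfl) ki hD h
      have g2 := Cmp_Bm (Or.inr rfl) y1 hmn g
      rw [y3, y4] at g2
      exact Cmp_to_equivInf y2 (modelInf_eq _ _) g2
    · obtain ⟨D, hD, h⟩ := kap_low_all hlow ki (by
        rcases hi with ⟨h, h'⟩ | h
        · exact Or.inr ⟨r2.1 h, div_nonneg (by linarith) hpi'.le⟩
        · exact Or.inl (r3.1 h))
      have g2 := Cmp_Bm (Or.inr rfl) one_pos hmn (Gm_Cmp_lin hB hpos hD h)
      refine Cmp_to_equivInf (by norm_num) ?_ g2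
      filter_upwards with t
      simp [PL]
    · obtain ⟨K, hK, hK2⟩ := young_double hB c0 ci
      exact hardy_norm hm hmn hB hpos hfin hK hK2
    · intro A hA hH f _ hf
      obtain ⟨C, hC, h⟩ := Bm_le_of_hardy hmn hA hB hpos hfin hH
      exact lux_of_dom hC h f hf
  · refine not_exists_dom hmn hB hpos hfin k0 ?_
    rcases h0 with ⟨h, h'⟩ | h
    · exact Or.inr ⟨q2.1 h, div_neg_of_neg_of_pos (by linarith) hp0'⟩
    · exact Or.inl (q3.1 h)


/-- optimal Orlicz domain spaces for Zygmund-type Orlicz spaces. -/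
theorem statement18 (n m : ℕ) (hn : 2 ≤ n) (hm : 1 ≤ m) (hmn : m < n)
    (p0 pi a0 ai : ℝ) (hp0 : 1 ≤ p0) (hpi : 1 ≤ pi)
    (hp0a : p0 = 1 → a0 ≤ 0) (hpia : pi = 1 → 0 ≤ ai)
    (B : ℝ → ℝ≥0∞) (hB : IsYoung B)
    (hB0 : EquivNearZero B (modelZero p0 a0)) (hBi : EquivNearInfty B (modelInf pi ai)) :
    (((p0 = (n : ℝ)/((n : ℝ) - (m : ℝ)) ∧ a0 ≤ 0) ∨ (n : ℝ)/((n : ℝ) - (m : ℝ)) < p0) →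
      EquivNearZero (Bm m n B)
        (modelZero ((n : ℝ) * p0 / ((n : ℝ) + (m : ℝ) * p0))
          ((n : ℝ) * a0 / ((n : ℝ) + (m : ℝ) * p0)))
      ∧ (((n : ℝ)/((n : ℝ) - (m : ℝ)) < pi ∨
            (pi = (n : ℝ)/((n : ℝ) - (m : ℝ)) ∧ 0 < ai)) →
          EquivNearInfty (Bm m n B)
            (modelInf ((n : ℝ) * pi / ((n : ℝ) + (m : ℝ) * pi))
              ((n : ℝ) * ai / ((n : ℝ) + (m : ℝ) * pi))))
      ∧ (((pi = (n : ℝ)/((n : ℝ) - (m : ℝ)) ∧ ai ≤ 0) ∨ pi < (n : ℝ)/((n : ℝ) - (m : ℝ))) →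
          EquivNearInfty (Bm m n B) (fun t => ENNReal.ofReal t))
      ∧ (∃ C : ℝ≥0∞, 0 < C ∧ C < ∞ ∧
          ∀ f : ℝ → ℝ≥0∞, Measurable f →
            luxNorm B (hardyOp m n f) ≤ C * luxNorm (Bm m n B) f)
      ∧ (∀ A : ℝ → ℝ≥0∞, IsYoung A →
          (∃ C : ℝ≥0∞, 0 < C ∧ C < ∞ ∧
            ∀ f : ℝ → ℝ≥0∞, Measurable f →
              luxNorm B (hardyOp m n f) ≤ C * luxNorm A f) →
          ∀ f : ℝ → ℝ≥0∞, Measurable f → luxNorm A f < ∞ → luxNorm (Bm m n B) f < ∞))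
    ∧
    (((p0 = (n : ℝ)/((n : ℝ) - (m : ℝ)) ∧ 0 < a0) ∨ p0 < (n : ℝ)/((n : ℝ) - (m : ℝ))) →
      ¬ ExistsOrliczDomain m n B) := by
  exact statement18_aux n m hm hmn p0 pi a0 ai hp0 hpi B hB hB0 hBi

end
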